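/- For the Wright–Fisher diffusion with selection with individual-level selection coefficient s > 0 and any bounded group-level selection function r, the extinction rate ρ_α(σ) of the unique quasi-stationary distribution on (0,1) for the extended extinction time τ_{0,1,∂} tends to +∞ as the neutral fluctuation parameter σ tends to +∞: lim_{σ→∞} ρ_α(σ) = +∞. -/

import Mathlib

open MeasureTheory ProbabilityTheory Filter Set
open scoped ENNReal NNReal Topology

noncomputable section

/-- The Wright–Fisher generator with selection `s` and diffusion parameter `σ`:
`𝓛_WF f(x) = -s x (1-x) f'(x) + (σ²/2) x (1-x) f''(x)`. -/
def LWF (s σ : ℝ) (f : ℝ → ℝ) : ℝ → ℝ := fun x =>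
  -s * x * (1 - x) * deriv f x + σ ^ 2 / 2 * (x * (1 - x)) * deriv (deriv f) x

/-- A (weak) solution of the Wright–Fisher SDE with selection
`dX_t = -s X_t (1-X_t) dt + σ √(X_t(1-X_t)) dB_t`, `X_0 ∼ μ₀`, characterized through
the associated martingale problem for the generator `LWF s σ`, enriched with an
independent standard exponential random variable `Tkill` used for the soft killing at
rate `-r ≥ 0`:  `τ_∂ = inf{t ≥ 0 : ∫₀ᵗ (-r(X_u)) du ≥ Tkill}`. -/
structure WFKilled (s σ : ℝ) (r : ℝ → ℝ) (μ₀ : Measure ℝ) where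
  (Ω : Type)
  [mΩ : MeasurableSpace Ω]
  (P : Measure Ω)
  (probP : IsProbabilityMeasure P)
  (X : ℝ → Ω → ℝ)
  (measX : ∀ t, Measurable (X t))
  (contX : ∀ ω, Continuous fun t => X t ω)
  (preZero : ∀ t ≤ (0:ℝ), X t = X 0)
  (range01 : ∀ t ω, X t ω ∈ Icc (0:ℝ) 1)
  (initLaw : P.map (X 0) = μ₀)
  (ℱ : Filtration ℝ mΩ)
  (adaptedX : Adapted ℱ X)
  (martProblem : ∀ f : ℝ → ℝ, ContDiff ℝ 2 f →
    Martingale (fun t ω => f (X t ω) - ∫ u in Ioc (0:ℝ) t, LWF s σ f (X u ω)) ℱ P)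
  (Tkill : Ω → ℝ)
  (measT : Measurable Tkill)
  (expLaw : ∀ t : ℝ, 0 ≤ t → P {ω | t < Tkill ω} = ENNReal.ofReal (Real.exp (-t)))
  (indepT : IndepFun (fun ω t => X t ω) Tkill P)

attribute [instance] WFKilled.mΩ WFKilled.probP

variable {s σ : ℝ} {r : ℝ → ℝ} {μ₀ : Measure ℝ}

/-- The survival event `{t < τ_∂}` for the soft killing at rate `-r`. -/
def WFKilled.aliveSoft (W : WFKilled s σ r μ₀) (t : ℝ) : Set W.Ω :=
  {ω | ∫ u in Ioc (0:ℝ) t, (-(r (W.X u ω))) < W.Tkill ω}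

/-- The event `{t < τ_0}`: the boundary point `0` has not been hit by time `t`. -/
def WFKilled.noHit0 (W : WFKilled s σ r μ₀) (t : ℝ) : Set W.Ω :=
  {ω | ∀ u ∈ Icc (0:ℝ) t, W.X u ω ≠ 0}

/-- The event `{t < τ_1}`: the boundary point `1` has not been hit by time `t`. -/
def WFKilled.noHit1 (W : WFKilled s σ r μ₀) (t : ℝ) : Set W.Ω :=
  {ω | ∀ u ∈ Icc (0:ℝ) t, W.X u ω ≠ 1}

/-- The event `{t < τ_{0,1,∂}}`. -/
def WFKilled.aliveAll (W : WFKilled s σ r μ₀) (t : ℝ) : Set W.Ω :=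
  W.aliveSoft t ∩ W.noHit0 t ∩ W.noHit1 t

/-- The law of `X_t` conditioned on an event `E` (e.g. survival up to time `t`). -/
def WFKilled.condLaw (W : WFKilled s σ r μ₀) (E : Set W.Ω) (t : ℝ) : Measure ℝ :=
  (W.P E)⁻¹ • (W.P.restrict E).map (W.X t)

/-- The hitting time of `0`, as an element of `ℝ≥0∞`. -/
def WFKilled.hit0 (W : WFKilled s σ r μ₀) (ω : W.Ω) : ℝ≥0∞ :=
  sInf {t : ℝ≥0∞ | ∃ u : ℝ, 0 ≤ u ∧ t = ENNReal.ofReal u ∧ W.X u ω = 0}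

/-- The hitting time of `1`, as an element of `ℝ≥0∞`. -/
def WFKilled.hit1 (W : WFKilled s σ r μ₀) (ω : W.Ω) : ℝ≥0∞ :=
  sInf {t : ℝ≥0∞ | ∃ u : ℝ, 0 ≤ u ∧ t = ENNReal.ofReal u ∧ W.X u ω = 1}

/-- The soft killing time `τ_∂`, as an element of `ℝ≥0∞`. -/
def WFKilled.killT (W : WFKilled s σ r μ₀) (ω : W.Ω) : ℝ≥0∞ :=
  sInf {t : ℝ≥0∞ | ∃ u : ℝ, 0 ≤ u ∧ t = ENNReal.ofReal u ∧
    W.Tkill ω ≤ ∫ v in Ioc (0:ℝ) u, (-(r (W.X v ω)))}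

/-- Quasi-stationary distribution on `(0,1)` for the extinction time `τ_{0,1,∂}`,
with extinction rate `ρ`: under any realization of the killed Wright–Fisher diffusion
started from `α`, one has `ℙ_α(X_t ∈ A ; t < τ_{0,1,∂}) = e^{-ρ t} α(A)`. -/
def IsQSD (s σ : ℝ) (r : ℝ → ℝ) (α : Measure ℝ) (ρ : ℝ) : Prop :=
  IsProbabilityMeasure α ∧ α (Ioo (0:ℝ) 1)ᶜ = 0 ∧
  ∀ W : WFKilled s σ r α, ∀ t : ℝ, 0 < t → ∀ A : Set ℝ, MeasurableSet A →
    W.P ({ω | W.X t ω ∈ A} ∩ W.aliveAll t) = ENNReal.ofReal (Real.exp (-(ρ * t))) * α A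

/-- Quasi-stationary distribution on `[0,1]` for the soft killing time `τ_∂` alone,
with extinction rate `ρ`. -/
def IsQSDsoft (s σ : ℝ) (r : ℝ → ℝ) (α : Measure ℝ) (ρ : ℝ) : Prop :=
  IsProbabilityMeasure α ∧ α (Icc (0:ℝ) 1)ᶜ = 0 ∧
  ∀ W : WFKilled s σ r α, ∀ t : ℝ, 0 < t → ∀ A : Set ℝ, MeasurableSet A →
    W.P ({ω | W.X t ω ∈ A} ∩ W.aliveSoft t) = ENNReal.ofReal (Real.exp (-(ρ * t))) * α A

/-- Survival capacity `η` with extinction rate `ρ`: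
`η(x) = e^{ρ t} 𝔼_x[η(X_t) ; t < τ_{0,1,∂}]`. -/
def IsSurvCap (s σ : ℝ) (r : ℝ → ℝ) (ρ : ℝ) (η : ℝ → ℝ) : Prop :=
  Measurable η ∧ ∀ x ∈ Icc (0:ℝ) 1, ∀ W : WFKilled s σ r (Measure.dirac x), ∀ t : ℝ, 0 < t →
    η x = Real.exp (ρ * t) * ∫ ω in W.aliveAll t, η (W.X t ω) ∂W.P

/-- Total variation distance between two (finite) measures on `ℝ`. -/
def tvDist (μ ν : Measure ℝ) : ℝ :=
  ⨆ A : Set ℝ, |(μ A).toReal - (ν A).toReal|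

/-- Existence of realizations of the killed Wright–Fisher diffusion from any initial law
on `[0,1]` (granted by the classical well-posedness of the Wright–Fisher SDE). -/
def WFExists (s σ : ℝ) (r : ℝ → ℝ) : Prop :=
  ∀ μ : Measure ℝ, IsProbabilityMeasure μ → μ (Icc (0:ℝ) 1)ᶜ = 0 →
    Nonempty (WFKilled s σ r μ)


namespace WFX

/-- bounded measurable functions -/
def BM {Ω : Type} (m : MeasurableSpace Ω) (f : Ω → ℝ) : Prop :=
  Measurable[m] f ∧ ∃ C, ∀ ω, |f ω| ≤ C

namespace BM
variable {Ω : Type} {m m' : MeasurableSpace Ω} {f g : Ω → ℝ}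

lemma mono (h : BM m f) (hm : m ≤ m') : BM m' f := ⟨h.1.mono hm le_rfl, h.2⟩

lemma const (c : ℝ) : BM m (fun _ => c) := ⟨measurable_const, |c|, fun _ => le_rfl⟩

lemma add (hf : BM m f) (hg : BM m g) : BM m (fun ω => f ω + g ω) := by
  obtain ⟨C, hC⟩ := hf.2
  obtain ⟨D, hD⟩ := hg.2
  exact ⟨hf.1.add hg.1, C + D, fun ω => (abs_add_le _ _).trans (add_le_add (hC ω) (hD ω))⟩

lemma mul (hf : BM m f) (hg : BM m g) : BM m (fun ω => f ω * g ω) := by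
  obtain ⟨C, hC⟩ := hf.2
  obtain ⟨D, hD⟩ := hg.2
  refine ⟨hf.1.mul hg.1, C * D, fun ω => ?_⟩
  rw [abs_mul]
  exact mul_le_mul (hC ω) (hD ω) (abs_nonneg _) ((abs_nonneg _).trans (hC ω))

lemma sub (hf : BM m f) (hg : BM m g) : BM m (fun ω => f ω - g ω) := by
  simpa [sub_eq_add_neg] using hf.add ((const (-1)).mul hg)

lemma pow (hf : BM m f) (n : ℕ) : BM m (fun ω => f ω ^ n) := by
  obtain ⟨C, hC⟩ := hf.2
  refine ⟨hf.1.pow_const n, C ^ n, fun ω => ?_⟩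
  rw [abs_pow]
  exact pow_le_pow_left₀ (abs_nonneg _) (hC ω) n

lemma abs (hf : BM m f) : BM m (fun ω => |f ω|) := by
  obtain ⟨C, hC⟩ := hf.2
  exact ⟨hf.1.abs, C, fun ω => by simpa using hC ω⟩

lemma int (hf : BM m f) (P : Measure[m] Ω) [IsFiniteMeasure P] : Integrable f P := by
  obtain ⟨C, hC⟩ := hf.2
  exact Integrable.of_bound hf.1.aestronglyMeasurable C (ae_of_all _ hC)

lemma of01 (hf : Measurable[m] f) (h : ∀ ω, f ω ∈ Icc (0:ℝ) 1) : BM m f :=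
  ⟨hf, 1, fun ω => abs_le.2 ⟨by linarith [(h ω).1], (h ω).2⟩⟩

lemma comp01 {φ : ℝ → ℝ} (hφ : Continuous φ) (hf : Measurable[m] f) (h : ∀ ω, f ω ∈ Icc (0:ℝ) 1) :
    BM m (fun ω => φ (f ω)) := by
  obtain ⟨C, hC⟩ := (isCompact_Icc (a := (0:ℝ)) (b := 1)).exists_bound_of_continuousOn hφ.continuousOn
  exact ⟨hφ.measurable.comp hf, C, fun ω => hC _ (h ω)⟩

end BM

/-- the discrete approximating chain -/
structure IsChain {Ω : Type} [m : MeasurableSpace Ω] (P : Measure Ω) (G : Filtration ℕ m)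
    (Y ξ : ℕ → Ω → ℝ) (p : ℝ → ℝ) (ε : ℝ) : Prop where
  measY : ∀ k, Measurable[G k] (Y k)
  rangeY : ∀ k ω, Y k ω ∈ Icc (0:ℝ) 1
  measξ : ∀ k, Measurable (ξ k)
  rangeξ : ∀ k ω, ξ k ω = 0 ∨ ξ k ω = 1
  step : ∀ k ω, Y (k+1) ω = (1 - ε) * Y k ω + ε * ξ k ω
  cond : ∀ k Ψ, BM (G k) Ψ → ∫ ω, ξ k ω * Ψ ω ∂P = ∫ ω, p (Y k ω) * Ψ ω ∂P

lemma exists_chain (α : Measure ℝ) [IsProbabilityMeasure α] (hα : α (Ioo (0:ℝ) 1)ᶜ = 0)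
    (p : ℝ → ℝ) (hpm : Measurable p) (hp : ∀ x ∈ Icc (0:ℝ) 1, p x ∈ Icc (0:ℝ) 1)
    (ε : ℝ) (hε : ε ∈ Icc (0:ℝ) 1) :
    ∃ (Ω : Type) (m : MeasurableSpace Ω) (P : Measure Ω) (_ : IsProbabilityMeasure P)
      (G : Filtration ℕ m) (Y ξ : ℕ → Ω → ℝ), IsChain P G Y ξ p ε ∧ P.map (Y 0) = α := by
  let ν : ℕ → Measure ℝ := fun n => if n = 0 then α else volume.restrict (Icc (0:ℝ) 1)
  have hν : ∀ n, IsProbabilityMeasure (ν n) := by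
    intro n
    by_cases h : n = 0
    · simp only [ν, h, if_true]; infer_instance
    · simp only [ν, h, if_false]
      exact ⟨by simp⟩
  obtain ⟨Ω, m, P, Z, hZm, hZl, hZi, hP⟩ := exists_hasLaw_indepFun (fun _ : ℕ => ℝ) ν
  have hZs : ∀ i, StronglyMeasurable (Z i) := fun i => (hZm i).stronglyMeasurable
  let Y : ℕ → Ω → ℝ := fun n => Nat.rec (fun ω => max 0 (min 1 (Z 0 ω)))
    (fun k y ω => (1 - ε) * y ω + ε * (if Z (k+1) ω ≤ p (y ω) then 1 else 0)) n
  have hY0 : Y 0 = fun ω => max 0 (min 1 (Z 0 ω)) := rfl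
  have hYs : ∀ k ω, Y (k+1) ω = (1 - ε) * Y k ω + ε * (if Z (k+1) ω ≤ p (Y k ω) then 1 else 0) :=
    fun k ω => rfl
  let G := Filtration.natural Z hZs
  have hZG : ∀ k, Measurable[G k] (Z k) := fun k =>
    (Filtration.stronglyAdapted_natural hZs k).measurable
  have hYG : ∀ k, Measurable[G k] (Y k) := by
    intro k
    induction k with
    | zero =>
      rw [hY0]
      exact measurable_const.max (measurable_const.min (hZG 0))
    | succ k ih =>
      have h1 : Measurable[G (k+1)] (Y k) := ih.mono (G.mono (Nat.le_succ k)) le_rfl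
      have : Y (k+1) = fun ω => (1 - ε) * Y k ω + ε * (if Z (k+1) ω ≤ p (Y k ω) then 1 else 0) :=
        funext (hYs k)
      rw [this]
      refine (measurable_const.mul h1).add (measurable_const.mul (Measurable.ite ?_ measurable_const measurable_const))
      exact measurableSet_le (hZG (k+1)) (hpm.comp h1)
  have hYr : ∀ k ω, Y k ω ∈ Icc (0:ℝ) 1 := by
    intro k
    induction k with
    | zero => intro ω; rw [hY0]; exact ⟨le_max_left _ _, max_le zero_le_one (min_le_left _ _)⟩
    | succ k ih =>
      intro ω
      rw [hYs]
      obtain ⟨h1, h2⟩ := ih ω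
      obtain ⟨e1, e2⟩ := hε
      split_ifs
      · constructor <;> nlinarith
      · constructor <;> nlinarith
  refine ⟨Ω, m, P, hP, G, Y, fun k ω => if Z (k+1) ω ≤ p (Y k ω) then 1 else 0, ?_, ?_⟩
  · refine ⟨hYG, hYr, ?_, ?_, hYs, ?_⟩
    · intro k
      refine Measurable.ite ?_ measurable_const measurable_const
      exact measurableSet_le (hZm (k+1)) (hpm.comp ((hYG k).mono (G.le k) le_rfl))
    · intro k ω
      by_cases h : Z (k+1) ω ≤ p (Y k ω) <;> simp [h]
    · intro k Ψ hΨ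
      have hind := hZi.indep_comap_natural_of_lt hZs (Nat.lt_succ_self k)
      let W : Ω → ℝ × ℝ := fun ω => (Y k ω, Ψ ω)
      have hW : Measurable[G k] W := (hYG k).prodMk hΨ.1
      have hWm : Measurable W := hW.mono (G.le k) le_rfl
      have hWZ : IndepFun W (Z (k+1)) P := by
        rw [IndepFun_iff_Indep]
        exact indep_of_indep_of_le_left hind.symm hW.comap_le
      have hmap := hWZ.map_prod_eq_prod_map_map hWm.aemeasurable (hZm _).aemeasurable
      have hlaw : P.map (Z (k+1)) = volume.restrict (Icc (0:ℝ) 1) := by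
        rw [(hZl (k+1)).map_eq]; simp [ν]
      let H : (ℝ × ℝ) × ℝ → ℝ := fun q => (if q.2 ≤ p q.1.1 then 1 else 0) * q.1.2
      have hH : Measurable H := by
        refine Measurable.mul (Measurable.ite ?_ measurable_const measurable_const) (by fun_prop)
        exact measurableSet_le (by fun_prop) (by fun_prop)
      have hp2 : Measurable fun ω => (W ω, Z (k+1) ω) := hWm.prodMk (hZm _)
      have e1 : ∫ ω, (if Z (k+1) ω ≤ p (Y k ω) then (1:ℝ) else 0) * Ψ ω ∂P
          = ∫ q, H q ∂(P.map fun ω => (W ω, Z (k+1) ω)) := by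
        rw [integral_map hp2.aemeasurable hH.aestronglyMeasurable]
      have hPW : IsProbabilityMeasure (P.map W) := Measure.isProbabilityMeasure_map hWm.aemeasurable
      have hPZ : IsProbabilityMeasure (P.map (Z (k+1))) :=
        Measure.isProbabilityMeasure_map (hZm _).aemeasurable
      obtain ⟨C, hC⟩ := hΨ.2
      have hHi : Integrable H ((P.map W).prod (P.map (Z (k+1)))) := by
        rw [← hmap]
        refine (integrable_map_measure hH.aestronglyMeasurable hp2.aemeasurable).2 ?_
        refine Integrable.of_bound (hH.comp hp2).aestronglyMeasurable C (ae_of_all _ fun ω => ?_)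
        simp only [Function.comp, H, W, Real.norm_eq_abs]
        split_ifs
        · simpa using hC ω
        · simpa using (abs_nonneg _).trans (hC ω)
      rw [e1, hmap, integral_prod _ hHi, integral_map hWm.aemeasurable]
      · refine integral_congr_ae (ae_of_all _ fun ω => ?_)
        simp only [H, W]
        rw [integral_mul_const, hlaw]
        congr 1
        have hpy := hp _ (hYr k ω)
        have : (fun u : ℝ => if u ≤ p (Y k ω) then (1:ℝ) else 0)
            = (Iic (p (Y k ω))).indicator (fun _ => 1) := by
          ext u; simp [indicator]
        rw [this, integral_indicator_const _ measurableSet_Iic, measureReal_restrict_apply measurableSet_Iic]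
        have : Iic (p (Y k ω)) ∩ Icc 0 1 = Icc 0 (p (Y k ω)) := by
          ext u; simp only [mem_inter_iff, mem_Iic, mem_Icc]
          constructor
          · rintro ⟨a, b, c⟩; exact ⟨b, a⟩
          · rintro ⟨a, b⟩; exact ⟨b, a, b.trans hpy.2⟩
        rw [this]
        simp [hpy.1]
      · exact (hH.stronglyMeasurable.integral_prod_right' ).aestronglyMeasurable
  · have h0 : P.map (Z 0) = α := by rw [(hZl 0).map_eq]; simp [ν]
    rw [← h0]
    refine Measure.map_congr ?_
    have : ∀ᵐ x ∂(P.map (Z 0)), x ∈ Ioo (0:ℝ) 1 := by rw [h0]; exact hα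
    filter_upwards [ae_of_ae_map (hZm 0).aemeasurable this] with ω hω
    rw [hY0]
    simp only
    rw [min_eq_right hω.2.le, max_eq_right hω.1.le]

end WFX

namespace WFX

/-- success probability -/
def pfun (s σ ε : ℝ) (x : ℝ) : ℝ := x - s * ε / σ ^ 2 * (x * (1 - x))
/-- drift -/
def bfun (s : ℝ) (x : ℝ) : ℝ := -s * x * (1 - x)
/-- diffusion -/
def afun (σ : ℝ) (x : ℝ) : ℝ := σ ^ 2 * (x * (1 - x))

lemma xx_bd {x : ℝ} (hx : x ∈ Icc (0:ℝ) 1) : x * (1 - x) ∈ Icc (0:ℝ) 1 := by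
  obtain ⟨h1, h2⟩ := hx
  constructor <;> nlinarith

lemma xx_lip {x y : ℝ} (hx : x ∈ Icc (0:ℝ) 1) (hy : y ∈ Icc (0:ℝ) 1) :
    |x * (1 - x) - y * (1 - y)| ≤ |x - y| := by
  have : x * (1 - x) - y * (1 - y) = (x - y) * (1 - x - y) := by ring
  rw [this, abs_mul]
  have : |1 - x - y| ≤ 1 := abs_le.2 ⟨by linarith [hx.2, hy.2], by linarith [hx.1, hy.1]⟩
  nlinarith [abs_nonneg (x - y)]

lemma cont_bfun (s : ℝ) : Continuous (bfun s) := by unfold bfun; fun_prop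
lemma cont_afun (σ : ℝ) : Continuous (afun σ) := by unfold afun; fun_prop

lemma accum (u : ℕ → ℝ) (c r : ℝ) (n : ℕ) (h : ∀ j < n, |u (j+1) - u j - c| ≤ r) :
    |u n - u 0 - n * c| ≤ n * r := by
  induction n with
  | zero => simp
  | succ n ih =>
    have h1 := ih (fun j hj => h j (hj.trans (Nat.lt_succ_self n)))
    have h2 := h n (Nat.lt_succ_self n)
    have : u (n+1) - u 0 - (n+1 : ℕ) * c = (u n - u 0 - n * c) + (u (n+1) - u n - c) := by
      push_cast; ring
    rw [this]
    push_cast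
    linarith [abs_add_le (u n - u 0 - n * c) (u (n+1) - u n - c)]

lemma accum_le (u : ℕ → ℝ) (r : ℝ) (n : ℕ) (h : ∀ j < n, u (j+1) ≤ u j + r) :
    u n ≤ u 0 + n * r := by
  induction n with
  | zero => simp
  | succ n ih =>
    have h1 := ih (fun j hj => h j (hj.trans (Nat.lt_succ_self n)))
    have h2 := h n (Nat.lt_succ_self n)
    push_cast
    linarith

lemma abs_int_le {Ω : Type} [m : MeasurableSpace Ω] {P : Measure Ω} [IsProbabilityMeasure P]
    {d : Ω → ℝ} (hd : BM m d) {q : ℝ} (hq : ∫ ω, d ω ^ 2 ∂P ≤ q) : ∫ ω, |d ω| ∂P ≤ √q := by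
  apply Real.le_sqrt_of_sq_le
  refine le_trans ?_ hq
  set M := ∫ ω, |d ω| ∂P with hM
  have h0 : 0 ≤ ∫ ω, (|d ω| - M) ^ 2 ∂P := integral_nonneg fun ω => sq_nonneg _
  have e : ∀ ω, (|d ω| - M) ^ 2 = d ω ^ 2 + (- (2 * M) * |d ω| + M ^ 2) := fun ω => by
    rw [sub_sq, sq_abs]; ring
  simp_rw [e] at h0
  rw [integral_add ((hd.pow 2).int P) ((((BM.const _).mul hd.abs).add (BM.const _)).int P),
    integral_add (((BM.const _).mul hd.abs).int P) ((BM.const _).int P), integral_const_mul] at h0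
  simp only [integral_const, probReal_univ, smul_eq_mul, one_mul, ← hM] at h0
  nlinarith

lemma abs_int_mul_le {Ω : Type} [m : MeasurableSpace Ω] {P : Measure Ω} [IsProbabilityMeasure P]
    {f d : Ω → ℝ} (hd : BM m d) {K R : ℝ} (hfd : ∀ ω, |f ω| ≤ K * |d ω|)
    (hR : K * ∫ ω, |d ω| ∂P ≤ R) : |∫ ω, f ω ∂P| ≤ R := by
  refine le_trans ?_ hR
  rw [← integral_const_mul]
  exact (abs_integral_le_integral_abs).trans (integral_mono_of_nonneg (ae_of_all _ fun _ => abs_nonneg _)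
    (((BM.const K).mul hd.abs).int P) (ae_of_all _ hfd))

section chain
variable {Ω : Type} [m : MeasurableSpace Ω] {P : Measure Ω} [IsProbabilityMeasure P]
    {G : Filtration ℕ m} {Y ξ : ℕ → Ω → ℝ} {s σ ε : ℝ}

lemma IsChain.bmY (hc : IsChain P G Y ξ (pfun s σ ε) ε) {k l : ℕ} (h : k ≤ l) : BM (G l) (Y k) :=
  (BM.of01 (hc.measY k) (hc.rangeY k)).mono (G.mono h)

lemma IsChain.bmY' (hc : IsChain P G Y ξ (pfun s σ ε) ε) (k : ℕ) : BM m (Y k) :=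
  (BM.of01 (hc.measY k) (hc.rangeY k)).mono (G.le k)

lemma IsChain.bmξ (hc : IsChain P G Y ξ (pfun s σ ε) ε) (k : ℕ) : BM m (ξ k) :=
  BM.of01 (hc.measξ k) fun ω => by rcases hc.rangeξ k ω with h | h <;> simp [h]

lemma IsChain.step1 (hc : IsChain P G Y ξ (pfun s σ ε) ε) (hσ : 0 < σ) (k : ℕ) {Ψ : Ω → ℝ}
    (hΨ : BM (G k) Ψ) :
    ∫ ω, (Y (k+1) ω - Y k ω) * Ψ ω ∂P = ε ^ 2 / σ ^ 2 * ∫ ω, bfun s (Y k ω) * Ψ ω ∂P := by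
  have hΨ' := hΨ.mono (G.le k)
  have e : ∀ ω, (Y (k+1) ω - Y k ω) * Ψ ω = ε * (ξ k ω * Ψ ω) - ε * (Y k ω * Ψ ω) := fun ω => by
    rw [hc.step]; ring
  simp_rw [e]
  rw [integral_sub (((BM.const _).mul ((hc.bmξ k).mul hΨ')).int P)
    (((BM.const _).mul ((hc.bmY' k).mul hΨ')).int P), integral_const_mul, integral_const_mul,
    hc.cond k Ψ hΨ, ← integral_const_mul, ← integral_const_mul, ← integral_const_mul, ← integral_sub]
  · refine integral_congr_ae (ae_of_all _ fun ω => ?_)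
    simp only [pfun, bfun]
    field_simp
    ring
  · refine BM.int (m := m) ((BM.const _).mul (BM.mul ?_ hΨ')) P
    exact (BM.comp01 (φ := pfun s σ ε) (by unfold pfun; fun_prop) (hc.bmY' k).1 (hc.rangeY k))
  · exact ((BM.const _).mul ((hc.bmY' k).mul hΨ')).int P

lemma IsChain.step2 (hc : IsChain P G Y ξ (pfun s σ ε) ε) (hσ : 0 < σ) (k : ℕ) {Ψ : Ω → ℝ}
    (hΨ : BM (G k) Ψ) :
    ∫ ω, (Y (k+1) ω - Y k ω) ^ 2 * Ψ ω ∂P = ε ^ 2 / σ ^ 2 * ∫ ω, (afun σ (Y k ω)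
      - s * ε * (Y k ω * (1 - Y k ω)) * (1 - 2 * Y k ω)) * Ψ ω ∂P := by
  have hΨ' := hΨ.mono (G.le k)
  have hY := hc.bmY' k
  have hYk := hc.bmY (le_refl k)
  have e : ∀ ω, (Y (k+1) ω - Y k ω) ^ 2 * Ψ ω = ε ^ 2 * (ξ k ω * ((1 - 2 * Y k ω) * Ψ ω))
      + ε ^ 2 * (Y k ω ^ 2 * Ψ ω) := fun ω => by
    rw [hc.step]
    rcases hc.rangeξ k ω with h | h <;> rw [h] <;> ring
  have b1 : BM (G k) (fun ω => (1 - 2 * Y k ω) * Ψ ω) :=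
    (((BM.const 1).sub ((BM.const 2).mul hYk)).mul hΨ)
  have b1' := b1.mono (G.le k)
  simp_rw [e]
  rw [integral_add (((BM.const _).mul ((hc.bmξ k).mul b1')).int P)
    (((BM.const _).mul ((hY.pow 2).mul hΨ')).int P), integral_const_mul, integral_const_mul,
    hc.cond k _ b1, ← integral_const_mul, ← integral_const_mul, ← integral_const_mul, ← integral_add]
  · refine integral_congr_ae (ae_of_all _ fun ω => ?_)
    simp only [pfun, afun]
    field_simp
    ring
  · refine BM.int (m := m) ((BM.const _).mul (BM.mul ?_ b1')) P
    exact (BM.comp01 (φ := pfun s σ ε) (by unfold pfun; fun_prop) (hc.bmY' k).1 (hc.rangeY k))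
  · exact ((BM.const _).mul ((hY.pow 2).mul hΨ')).int P

lemma ae_bd (hs : 0 < s) (hε : ε ∈ Icc (0:ℝ) 1) {x : ℝ} (hx : x ∈ Icc (0:ℝ) 1) :
    |s * ε * (x * (1 - x)) * (1 - 2 * x)| ≤ s * ε := by
  have h1 := xx_bd hx
  rw [abs_mul, abs_of_nonneg (mul_nonneg (mul_nonneg hs.le hε.1) h1.1)]
  have h2 : |1 - 2 * x| ≤ 1 := abs_le.2 ⟨by linarith [hx.2], by linarith [hx.1]⟩
  have h3 : 0 ≤ s * ε := mul_nonneg hs.le hε.1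
  calc s * ε * (x * (1 - x)) * |1 - 2 * x| ≤ s * ε * 1 * 1 := by
        gcongr
        exact h1.2
    _ = s * ε := by ring

lemma ae_bd' (hs : 0 < s) (hε : ε ∈ Icc (0:ℝ) 1) {x : ℝ} (hx : x ∈ Icc (0:ℝ) 1) :
    afun σ x - s * ε * (x * (1 - x)) * (1 - 2 * x) ≤ σ ^ 2 + s := by
  have h1 := (abs_le.1 (ae_bd hs hε hx)).1
  have h2 := xx_bd hx
  unfold afun
  nlinarith [hε.2, sq_nonneg σ, h2.2, h2.1]

lemma b_bd (hs : 0 < s) {x : ℝ} (hx : x ∈ Icc (0:ℝ) 1) : |bfun s x| ≤ s := by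
  have h1 := xx_bd hx
  have : bfun s x = - (s * (x * (1 - x))) := by unfold bfun; ring
  rw [this, abs_neg, abs_of_nonneg (mul_nonneg hs.le h1.1)]
  nlinarith [h1.2]

lemma b_lip (hs : 0 < s) {x y : ℝ} (hx : x ∈ Icc (0:ℝ) 1) (hy : y ∈ Icc (0:ℝ) 1) :
    |bfun s x - bfun s y| ≤ s * |x - y| := by
  have : bfun s x - bfun s y = - (s * (x * (1 - x) - y * (1 - y))) := by unfold bfun; ring
  rw [this, abs_neg, abs_mul, abs_of_pos hs]
  exact mul_le_mul_of_nonneg_left (xx_lip hx hy) hs.le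

lemma a_lip {x y : ℝ} (hx : x ∈ Icc (0:ℝ) 1) (hy : y ∈ Icc (0:ℝ) 1) :
    |afun σ x - afun σ y| ≤ σ ^ 2 * |x - y| := by
  have : afun σ x - afun σ y = (σ ^ 2 * (x * (1 - x) - y * (1 - y))) := by unfold afun; ring
  rw [this, abs_mul, abs_of_nonneg (sq_nonneg σ)]
  exact mul_le_mul_of_nonneg_left (xx_lip hx hy) (sq_nonneg σ)

lemma sub01 {x y : ℝ} (hx : x ∈ Icc (0:ℝ) 1) (hy : y ∈ Icc (0:ℝ) 1) : |x - y| ≤ 1 :=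
  abs_le.2 ⟨by linarith [hx.1, hy.2], by linarith [hx.2, hy.1]⟩

lemma IsChain.aeBM (hc : IsChain P G Y ξ (pfun s σ ε) ε) (k : ℕ) :
    BM m (fun ω => afun σ (Y k ω) - s * ε * (Y k ω * (1 - Y k ω)) * (1 - 2 * Y k ω)) :=
  BM.comp01 (φ := fun x => afun σ x - s * ε * (x * (1 - x)) * (1 - 2 * x))
    (by unfold afun; fun_prop) (hc.bmY' k).1 (hc.rangeY k)

lemma IsChain.q1 (hc : IsChain P G Y ξ (pfun s σ ε) ε) (hs : 0 < s) (hσ : 0 < σ)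
    (hε : ε ∈ Icc (0:ℝ) 1) (l n : ℕ) :
    ∫ ω, (Y (l+n) ω - Y l ω) ^ 2 ∂P ≤ (3 * s + σ ^ 2) * (n * (ε ^ 2 / σ ^ 2)) := by
  have hh : 0 ≤ ε ^ 2 / σ ^ 2 := by positivity
  have := accum_le (fun n => ∫ ω, (Y (l+n) ω - Y l ω) ^ 2 ∂P) ((3 * s + σ ^ 2) * (ε ^ 2 / σ ^ 2)) n ?_
  · simp at this; linarith
  intro j _
  simp only [← add_assoc]
  set k := l + j
  have hd : BM (G k) (fun ω => Y k ω - Y l ω) := (hc.bmY le_rfl).sub (hc.bmY (Nat.le_add_right l j))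
  have hd' := hd.mono (G.le k)
  have hΔ : BM m (fun ω => Y (k+1) ω - Y k ω) := (hc.bmY' _).sub (hc.bmY' _)
  have e : ∀ ω, (Y (k+1) ω - Y l ω) ^ 2 = (Y k ω - Y l ω) ^ 2 +
      ((Y (k+1) ω - Y k ω) * (2 * (Y k ω - Y l ω)) + (Y (k+1) ω - Y k ω) ^ 2 * 1) := fun ω => by ring
  simp_rw [e]
  rw [integral_add ((hd'.pow 2).int P) (((hΔ.mul ((BM.const _).mul hd')).add ((hΔ.pow 2).mul (BM.const _))).int P),
    integral_add ((hΔ.mul ((BM.const _).mul hd')).int P) (((hΔ.pow 2).mul (BM.const _)).int P),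
    hc.step1 hσ k ((BM.const _).mul hd), hc.step2 hσ k (BM.const _), ← mul_add]
  have i1 : ∫ ω, bfun s (Y k ω) * (2 * (Y k ω - Y l ω)) ∂P ≤ 2 * s := by
    have : ∫ ω, bfun s (Y k ω) * (2 * (Y k ω - Y l ω)) ∂P ≤ ∫ ω, 2 * s ∂P := by
      refine integral_mono (((BM.comp01 (cont_bfun s) (hc.bmY' k).1 (hc.rangeY k)).mul
        ((BM.const _).mul hd')).int P) ((BM.const _).int P) fun ω => ?_
      have h1 := b_bd hs (hc.rangeY k ω)
      have h2 := sub01 (hc.rangeY k ω) (hc.rangeY l ω)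
      refine (le_abs_self _).trans ?_
      rw [abs_mul, abs_mul, abs_two]
      nlinarith [abs_nonneg (bfun s (Y k ω)), abs_nonneg (Y k ω - Y l ω)]
    simpa using this
  have i2 : ∫ ω, (afun σ (Y k ω) - s * ε * (Y k ω * (1 - Y k ω)) * (1 - 2 * Y k ω)) * 1 ∂P
      ≤ σ ^ 2 + s := by
    have : ∫ ω, (afun σ (Y k ω) - s * ε * (Y k ω * (1 - Y k ω)) * (1 - 2 * Y k ω)) * 1 ∂P
      ≤ ∫ ω, (σ ^ 2 + s) ∂P := by
      refine integral_mono (((hc.aeBM k).mul (BM.const _)).int P) ((BM.const _).int P) fun ω => ?_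
      simp only [mul_one]
      exact ae_bd' hs hε (hc.rangeY k ω)
    simpa using this
  nlinarith

lemma IsChain.q2 (hc : IsChain P G Y ξ (pfun s σ ε) ε) (hs : 0 < s) (hσ : 0 < σ)
    (hε : ε ∈ Icc (0:ℝ) 1) (l n : ℕ) :
    ∫ ω, (Y (l+n) ω - Y l ω) ^ 4 ∂P ≤ (n * (ε ^ 2 / σ ^ 2)) * ((15 * s + 11 * σ ^ 2) *
      ((3 * s + σ ^ 2) * (n * (ε ^ 2 / σ ^ 2)) + ε ^ 2)) := by
  have hh : 0 ≤ ε ^ 2 / σ ^ 2 := by positivity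
  set h := ε ^ 2 / σ ^ 2 with hh'
  have := accum_le (fun n => ∫ ω, (Y (l+n) ω - Y l ω) ^ 4 ∂P) (h * ((15 * s + 11 * σ ^ 2) *
      ((3 * s + σ ^ 2) * (n * h) + ε ^ 2))) n ?_
  · simp at this; linarith
  intro j hj
  simp only [← add_assoc]
  have hq := hc.q1 hs hσ hε l j
  set k := l + j
  have hd : BM (G k) (fun ω => Y k ω - Y l ω) := (hc.bmY le_rfl).sub (hc.bmY (Nat.le_add_right l j))
  have hd' := hd.mono (G.le k)
  have hΔ : BM m (fun ω => Y (k+1) ω - Y k ω) := (hc.bmY' _).sub (hc.bmY' _)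
  have e : ∀ ω, (Y (k+1) ω - Y l ω) ^ 4 ≤ (Y k ω - Y l ω) ^ 4 +
      ((Y (k+1) ω - Y k ω) * (4 * (Y k ω - Y l ω) ^ 3) + (Y (k+1) ω - Y k ω) ^ 2 *
        (8 * (Y k ω - Y l ω) ^ 2 + 3 * ε ^ 2)) := fun ω => by
    have hD : (Y (k+1) ω - Y k ω) ^ 2 ≤ ε ^ 2 := by
      rw [hc.step]
      have := hc.rangeY k ω
      have e0 : (1 - ε) * Y k ω + ε * ξ k ω - Y k ω = ε * (ξ k ω - Y k ω) := by ring
      rw [e0, mul_pow]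
      have : (ξ k ω - Y k ω) ^ 2 ≤ 1 := by
        rcases hc.rangeξ k ω with h | h <;> rw [h] <;> nlinarith [this.1, this.2]
      nlinarith [sq_nonneg ε]
    have e1 : Y (k+1) ω - Y l ω = (Y k ω - Y l ω) + (Y (k+1) ω - Y k ω) := by ring
    rw [e1]
    generalize Y k ω - Y l ω = d at *
    generalize Y (k+1) ω - Y k ω = D at *
    have h5 : 0 ≤ D ^ 2 * (ε ^ 2 - D ^ 2) := mul_nonneg (sq_nonneg _) (by linarith)
    have h6 : 0 ≤ D ^ 2 * (d - D) ^ 2 := by positivity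
    nlinarith
  refine (integral_mono ((((hc.bmY' (k+1)).sub (hc.bmY' l)).pow 4).int P) ?_ e).trans ?_
  · exact BM.int (((hd'.pow 4).add ((hΔ.mul ((BM.const _).mul (hd'.pow 3))).add ((hΔ.pow 2).mul
      (((BM.const _).mul (hd'.pow 2)).add (BM.const _)))))) P
  have b2 : BM (G k) (fun ω => 8 * (Y k ω - Y l ω) ^ 2 + 3 * ε ^ 2) :=
    ((BM.const _).mul (hd.pow 2)).add (BM.const _)
  have b2' := b2.mono (G.le k)
  rw [integral_add ((hd'.pow 4).int P) (((hΔ.mul ((BM.const _).mul (hd'.pow 3))).add ((hΔ.pow 2).mul b2')).int P),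
    integral_add ((hΔ.mul ((BM.const _).mul (hd'.pow 3))).int P) (((hΔ.pow 2).mul b2').int P),
    hc.step1 hσ k ((BM.const _).mul (hd.pow 3)), hc.step2 hσ k b2, ← mul_add]
  have i1 : ∫ ω, bfun s (Y k ω) * (4 * (Y k ω - Y l ω) ^ 3) ∂P ≤ 4 * s * ∫ ω, (Y k ω - Y l ω) ^ 2 ∂P := by
    rw [← integral_const_mul]
    refine integral_mono (((BM.comp01 (cont_bfun s) (hc.bmY' k).1 (hc.rangeY k)).mul
        ((BM.const _).mul (hd'.pow 3))).int P) (((BM.const _).mul (hd'.pow 2)).int P) fun ω => ?_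
    have h1 := b_bd hs (hc.rangeY k ω)
    have h2 := sub01 (hc.rangeY k ω) (hc.rangeY l ω)
    refine (le_abs_self _).trans ?_
    simp only [abs_mul, abs_pow]
    rw [← sq_abs (Y k ω - Y l ω)]
    generalize |Y k ω - Y l ω| = d at *
    rw [abs_of_pos (by norm_num : (0:ℝ) < 4)]
    by_cases hd0 : 0 ≤ d
    · calc |bfun s (Y k ω)| * (4 * d ^ 3) ≤ s * (4 * (d ^ 2 * 1)) := by
            gcongr
            calc d ^ 3 = d ^ 2 * d := by ring
              _ ≤ d ^ 2 * 1 := by gcongr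
        _ = 4 * s * d ^ 2 := by ring
    · have : d ^ 3 ≤ 0 := by
        have : d ^ 3 = d ^ 2 * d := by ring
        rw [this]; exact mul_nonpos_of_nonneg_of_nonpos (sq_nonneg _) (by linarith)
      nlinarith [abs_nonneg (bfun s (Y k ω)), sq_nonneg d, mul_nonneg (abs_nonneg (bfun s (Y k ω))) (neg_nonneg.2 this), mul_nonneg hs.le (sq_nonneg d)]
  have i2 : ∫ ω, (afun σ (Y k ω) - s * ε * (Y k ω * (1 - Y k ω)) * (1 - 2 * Y k ω)) *
        (8 * (Y k ω - Y l ω) ^ 2 + 3 * ε ^ 2) ∂P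
      ≤ (σ ^ 2 + s) * (8 * ∫ ω, (Y k ω - Y l ω) ^ 2 ∂P + 3 * ε ^ 2) := by
    have e3 : (8 * ∫ ω, (Y k ω - Y l ω) ^ 2 ∂P + 3 * ε ^ 2) = ∫ ω, (8 * (Y k ω - Y l ω) ^ 2 + 3 * ε ^ 2) ∂P := by
      rw [integral_add (((BM.const _).mul (hd'.pow 2)).int P) ((BM.const _).int P), integral_const_mul]
      simp
    rw [e3, ← integral_const_mul]
    refine integral_mono (((hc.aeBM k).mul b2').int P) (((BM.const _).mul b2').int P) fun ω => ?_
    exact mul_le_mul_of_nonneg_right (ae_bd' hs hε (hc.rangeY k ω)) (by positivity)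
  have hjn : (j:ℝ) * h ≤ n * h := by
    have : (j:ℝ) ≤ n := by exact_mod_cast hj.le
    gcongr
  have hq2 : ∫ ω, (Y k ω - Y l ω) ^ 2 ∂P ≤ (3 * s + σ ^ 2) * (n * h) :=
    hq.trans (mul_le_mul_of_nonneg_left hjn (by positivity))
  have hq0 : 0 ≤ ∫ ω, (Y k ω - Y l ω) ^ 2 ∂P := integral_nonneg fun ω => sq_nonneg _
  generalize ∫ ω, (Y k ω - Y l ω) ^ 2 ∂P = q at *
  gcongr
  refine (add_le_add i1 i2).trans ?_
  have : 4 * s * q + (σ ^ 2 + s) * (8 * q + 3 * ε ^ 2) ≤ (15 * s + 11 * σ ^ 2) * (q + ε ^ 2) := by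
    nlinarith [mul_nonneg hs.le hq0, mul_nonneg (sq_nonneg σ) hq0, mul_nonneg hs.le (sq_nonneg ε), mul_nonneg (sq_nonneg σ) (sq_nonneg ε)]
  refine this.trans ?_
  gcongr

lemma IsChain.dabs (hc : IsChain P G Y ξ (pfun s σ ε) ε) (hs : 0 < s) (hσ : 0 < σ)
    (hε : ε ∈ Icc (0:ℝ) 1) (l : ℕ) {j n : ℕ} (hj : j < n) :
    ∫ ω, |Y (l+j) ω - Y l ω| ∂P ≤ √((3 * s + σ ^ 2) * (n * (ε ^ 2 / σ ^ 2))) := by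
  refine abs_int_le ((hc.bmY' _).sub (hc.bmY' _)) ((hc.q1 hs hσ hε l j).trans ?_)
  have : (j:ℝ) ≤ n := by exact_mod_cast hj.le
  gcongr

lemma IsChain.q3 (hc : IsChain P G Y ξ (pfun s σ ε) ε) (hs : 0 < s) (hσ : 0 < σ)
    (hε : ε ∈ Icc (0:ℝ) 1) (l n : ℕ) {Ψ : Ω → ℝ} (hΨ : BM (G l) Ψ) {B : ℝ} (hB : ∀ ω, |Ψ ω| ≤ B) (hB0 : 0 ≤ B) :
    |∫ ω, (Y (l+n) ω - Y l ω) * Ψ ω ∂P - (n * (ε ^ 2 / σ ^ 2)) * ∫ ω, bfun s (Y l ω) * Ψ ω ∂P|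
      ≤ (n * (ε ^ 2 / σ ^ 2)) * (s * B * √((3 * s + σ ^ 2) * (n * (ε ^ 2 / σ ^ 2)))) := by
  have hh : 0 ≤ ε ^ 2 / σ ^ 2 := by positivity
  have hΨ' := hΨ.mono (G.le l)
  have := accum (fun n => ∫ ω, (Y (l+n) ω - Y l ω) * Ψ ω ∂P) (ε ^ 2 / σ ^ 2 * ∫ ω, bfun s (Y l ω) * Ψ ω ∂P)
    (ε ^ 2 / σ ^ 2 * (s * B * √((3 * s + σ ^ 2) * (n * (ε ^ 2 / σ ^ 2))))) n ?_
  · simp only [add_zero, sub_self, zero_mul, integral_zero, sub_zero] at this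
    simpa only [mul_assoc] using this
  intro j hj
  simp only [← add_assoc]
  have hda := hc.dabs hs hσ hε l hj
  set k := l + j
  have hd' : BM m (fun ω => Y k ω - Y l ω) := (hc.bmY' _).sub (hc.bmY' _)
  have hΔ : BM m (fun ω => Y (k+1) ω - Y k ω) := (hc.bmY' _).sub (hc.bmY' _)
  have e : ∀ ω, (Y (k+1) ω - Y l ω) * Ψ ω = (Y (k+1) ω - Y k ω) * Ψ ω + (Y k ω - Y l ω) * Ψ ω :=
    fun ω => by ring
  simp_rw [e]
  have bb : ∀ i, BM m (fun ω => bfun s (Y i ω)) := fun i => BM.comp01 (cont_bfun s) (hc.bmY' i).1 (hc.rangeY i)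
  rw [integral_add ((hΔ.mul hΨ').int P) ((hd'.mul hΨ').int P), hc.step1 hσ k (hΨ.mono (G.mono (Nat.le_add_right l j))),
    add_sub_cancel_right, ← mul_sub, ← integral_sub (((bb _).mul hΨ').int P) (((bb _).mul hΨ').int P), abs_mul,
    abs_of_nonneg hh]
  gcongr
  refine abs_int_mul_le hd' (K := s * B) (fun ω => ?_) (by gcongr)
  rw [← sub_mul, abs_mul]
  have h1 := b_lip hs (hc.rangeY k ω) (hc.rangeY l ω)
  calc _ ≤ (s * |Y k ω - Y l ω|) * B := by gcongr; exact hB ω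
    _ = _ := by ring

lemma IsChain.q4 (hc : IsChain P G Y ξ (pfun s σ ε) ε) (hs : 0 < s) (hσ : 0 < σ)
    (hε : ε ∈ Icc (0:ℝ) 1) (l n : ℕ) {Ψ : Ω → ℝ} (hΨ : BM (G l) Ψ) {B : ℝ} (hB : ∀ ω, |Ψ ω| ≤ B) (hB0 : 0 ≤ B) :
    |∫ ω, (Y (l+n) ω - Y l ω) ^ 2 * Ψ ω ∂P - (n * (ε ^ 2 / σ ^ 2)) * ∫ ω, afun σ (Y l ω) * Ψ ω ∂P|
      ≤ (n * (ε ^ 2 / σ ^ 2)) * ((2 * s + σ ^ 2) * B * √((3 * s + σ ^ 2) * (n * (ε ^ 2 / σ ^ 2))) + s * ε * B) := by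
  have hh : 0 ≤ ε ^ 2 / σ ^ 2 := by positivity
  have hΨ' := hΨ.mono (G.le l)
  have := accum (fun n => ∫ ω, (Y (l+n) ω - Y l ω) ^ 2 * Ψ ω ∂P) (ε ^ 2 / σ ^ 2 * ∫ ω, afun σ (Y l ω) * Ψ ω ∂P)
    (ε ^ 2 / σ ^ 2 * ((2 * s + σ ^ 2) * B * √((3 * s + σ ^ 2) * (n * (ε ^ 2 / σ ^ 2))) + s * ε * B)) n ?_
  · simp only [add_zero, sub_self, zero_mul, integral_zero, sub_zero, ne_eq, OfNat.ofNat_ne_zero, not_false_eq_true, zero_pow] at this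
    simpa only [mul_assoc] using this
  intro j hj
  simp only [← add_assoc]
  have hda := hc.dabs hs hσ hε l hj
  set k := l + j
  have hlk : l ≤ k := Nat.le_add_right l j
  have hd : BM (G k) (fun ω => Y k ω - Y l ω) := (hc.bmY le_rfl).sub (hc.bmY hlk)
  have hd' := hd.mono (G.le k)
  have hΔ : BM m (fun ω => Y (k+1) ω - Y k ω) := (hc.bmY' _).sub (hc.bmY' _)
  have hΨk := hΨ.mono (G.mono hlk)
  have e : ∀ ω, (Y (k+1) ω - Y l ω) ^ 2 * Ψ ω = ((Y (k+1) ω - Y k ω) * (2 * (Y k ω - Y l ω) * Ψ ω) +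
      (Y (k+1) ω - Y k ω) ^ 2 * Ψ ω) + (Y k ω - Y l ω) ^ 2 * Ψ ω :=
    fun ω => by ring
  simp_rw [e]
  have ba : ∀ i, BM m (fun ω => afun σ (Y i ω)) := fun i => BM.comp01 (cont_afun σ) (hc.bmY' i).1 (hc.rangeY i)
  have bb : ∀ i, BM m (fun ω => bfun s (Y i ω)) := fun i => BM.comp01 (cont_bfun s) (hc.bmY' i).1 (hc.rangeY i)
  have b3 : BM (G k) (fun ω => 2 * (Y k ω - Y l ω) * Ψ ω) := ((BM.const _).mul hd).mul hΨk
  have b3' := b3.mono (G.le k)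
  rw [integral_add (((hΔ.mul b3').add ((hΔ.pow 2).mul hΨ')).int P) (((hd'.pow 2).mul hΨ').int P),
    integral_add ((hΔ.mul b3').int P) (((hΔ.pow 2).mul hΨ').int P), hc.step1 hσ k b3, hc.step2 hσ k hΨk,
    add_sub_cancel_right, ← mul_add, ← mul_sub,
    ← integral_add (((bb k).mul b3').int P) (((hc.aeBM k).mul hΨ').int P),
    ← integral_sub ((((bb k).mul b3').add ((hc.aeBM k).mul hΨ')).int P) (((ba _).mul hΨ').int P), abs_mul,
    abs_of_nonneg hh]
  gcongr
  have hpt : ∀ ω, |bfun s (Y k ω) * (2 * (Y k ω - Y l ω) * Ψ ω) + (afun σ (Y k ω) -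
      s * ε * (Y k ω * (1 - Y k ω)) * (1 - 2 * Y k ω)) * Ψ ω - afun σ (Y l ω) * Ψ ω|
      ≤ (2 * s + σ ^ 2) * B * |Y k ω - Y l ω| + s * ε * B := by
    intro ω
    have h1 := b_bd hs (hc.rangeY k ω)
    have h2 := a_lip (σ := σ) (hc.rangeY k ω) (hc.rangeY l ω)
    have h3 := ae_bd hs hε (hc.rangeY k ω)
    have e4 : bfun s (Y k ω) * (2 * (Y k ω - Y l ω) * Ψ ω) + (afun σ (Y k ω) -
      s * ε * (Y k ω * (1 - Y k ω)) * (1 - 2 * Y k ω)) * Ψ ω - afun σ (Y l ω) * Ψ ω =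
      (bfun s (Y k ω) * (2 * (Y k ω - Y l ω)) + (afun σ (Y k ω) - afun σ (Y l ω)) -
      s * ε * (Y k ω * (1 - Y k ω)) * (1 - 2 * Y k ω)) * Ψ ω := by ring
    rw [e4, abs_mul]
    have h4 : |bfun s (Y k ω) * (2 * (Y k ω - Y l ω))| ≤ s * (2 * |Y k ω - Y l ω|) := by
      rw [abs_mul, abs_mul, abs_two]; gcongr
    calc _ ≤ (s * (2 * |Y k ω - Y l ω|) + σ ^ 2 * |Y k ω - Y l ω| + s * ε) * B := by
          gcongr
          · have := mul_nonneg hs.le hε.1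
            positivity
          · refine (abs_sub _ _).trans (add_le_add ((abs_add_le _ _).trans (add_le_add h4 h2)) h3)
          · exact hB ω
      _ = _ := by ring
  refine abs_integral_le_integral_abs.trans ((integral_mono_of_nonneg (ae_of_all _ fun _ => abs_nonneg _)
    ((((BM.const _).mul hd'.abs).add (BM.const _)).int P) (ae_of_all _ hpt)).trans ?_)
  rw [integral_add (((BM.const _).mul hd'.abs).int P) ((BM.const _).int P), integral_const_mul]
  simp only [integral_const, probReal_univ, smul_eq_mul, one_mul]
  gcongr

end chain
end WFX

namespace WFX

/-- path space -/
def PathSp : Type := ℝ → Icc (0:ℝ) 1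

instance : TopologicalSpace PathSp := inferInstanceAs (TopologicalSpace (ℝ → Icc (0:ℝ) 1))
instance : CompactSpace PathSp := inferInstanceAs (CompactSpace (ℝ → Icc (0:ℝ) 1))
instance : T2Space PathSp := inferInstanceAs (T2Space (ℝ → Icc (0:ℝ) 1))
instance : MeasurableSpace PathSp := borel PathSp
instance : BorelSpace PathSp := ⟨rfl⟩

/-- evaluation -/
def evp (t : ℝ) (x : PathSp) : ℝ := ((x : ℝ → Icc (0:ℝ) 1) t : ℝ)

lemma cont_evp (t : ℝ) : Continuous (evp t) :=
  continuous_subtype_val.comp (continuous_apply (A := fun _ : ℝ => Icc (0:ℝ) 1) t)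

lemma evp_mem (t : ℝ) (x : PathSp) : evp t x ∈ Icc (0:ℝ) 1 := ((x : ℝ → Icc (0:ℝ) 1) t).2

/-- estimates for the approximations; `w u t` is the number of steps times step size -/
structure Apx (s σ : ℝ) (α : Measure ℝ) (ε : ℝ) (w : ℝ → ℝ → ℝ) (P : Measure PathSp) : Prop where
  init : P.map (evp 0) = α
  e2 : ∀ u t, u ≤ t → ∫ x, (evp t x - evp u x) ^ 2 ∂P ≤ (3 * s + σ ^ 2) * w u t
  e4 : ∀ u t, u ≤ t → ∫ x, (evp t x - evp u x) ^ 4 ∂P ≤ w u t * ((15 * s + 11 * σ ^ 2) *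
      ((3 * s + σ ^ 2) * w u t + ε ^ 2))
  d1 : ∀ u t, u ≤ t → ∀ (ι : Type) [Fintype ι] (τ : ι → ℝ), (∀ i, τ i ≤ u) → ∀ g : (ι → ℝ) → ℝ,
    Continuous g → ∀ B, 0 ≤ B → (∀ y, (∀ i, y i ∈ Icc (0:ℝ) 1) → |g y| ≤ B) →
    |∫ x, (evp t x - evp u x) * g (fun i => evp (τ i) x) ∂P
      - w u t * ∫ x, bfun s (evp u x) * g (fun i => evp (τ i) x) ∂P|
      ≤ w u t * (s * B * √((3 * s + σ ^ 2) * w u t))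
  d2 : ∀ u t, u ≤ t → ∀ (ι : Type) [Fintype ι] (τ : ι → ℝ), (∀ i, τ i ≤ u) → ∀ g : (ι → ℝ) → ℝ,
    Continuous g → ∀ B, 0 ≤ B → (∀ y, (∀ i, y i ∈ Icc (0:ℝ) 1) → |g y| ≤ B) →
    |∫ x, (evp t x - evp u x) ^ 2 * g (fun i => evp (τ i) x) ∂P
      - w u t * ∫ x, afun σ (evp u x) * g (fun i => evp (τ i) x) ∂P|
      ≤ w u t * ((2 * s + σ ^ 2) * B * √((3 * s + σ ^ 2) * w u t) + s * ε * B)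

/-- elapsed grid time -/
def wgrid (h u t : ℝ) : ℝ := (⌊t / h⌋₊ - ⌊u / h⌋₊ : ℕ) * h

lemma exists_apx (s σ : ℝ) (hs : 0 < s) (hσ : 0 < σ) (α : Measure ℝ) [IsProbabilityMeasure α]
    (hα : α (Ioo (0:ℝ) 1)ᶜ = 0) (ε : ℝ) (hε0 : 0 < ε) (hε1 : ε ≤ 1) (hε2 : s * ε ≤ σ ^ 2) :
    ∃ P : ProbabilityMeasure PathSp, Apx s σ α ε (wgrid (ε ^ 2 / σ ^ 2)) P := by
  have hε : ε ∈ Icc (0:ℝ) 1 := ⟨hε0.le, hε1⟩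
  have hpm : Continuous (pfun s σ ε) := by unfold pfun; fun_prop
  obtain ⟨Ω, m, P, hP, G, Y, ξ, hc, h0⟩ := exists_chain α hα (pfun s σ ε) hpm.measurable (by
    intro x hx
    have h1 := xx_bd hx
    have h2 : s * ε / σ ^ 2 ≤ 1 := by rw [div_le_one (by positivity)]; exact hε2
    have h3 : 0 ≤ s * ε / σ ^ 2 := by positivity
    unfold pfun
    constructor
    · nlinarith [hx.1, hx.2, h1.1, h1.2, mul_nonneg hx.1 hx.1]
    · nlinarith [hx.1, hx.2, h1.1, h1.2, mul_nonneg h3 h1.1]) ε hε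
  have hh : 0 < ε ^ 2 / σ ^ 2 := by positivity
  set h := ε ^ 2 / σ ^ 2 with hh'
  let Z1 : Ω → ℕ → Icc (0:ℝ) 1 := fun ω k => ⟨Y k ω, hc.rangeY k ω⟩
  have hZ1 : Measurable Z1 := measurable_pi_lambda _ fun k => (hc.bmY' k).1.subtype_mk
  let Z2 : (ℕ → Icc (0:ℝ) 1) → PathSp := fun y t => y ⌊t / h⌋₊
  have hZ2 : Continuous Z2 := continuous_pi (A := fun _ : ℝ => Icc (0:ℝ) 1) fun t => continuous_apply _
  have hZ : Measurable (Z2 ∘ Z1) := hZ2.measurable.comp hZ1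
  have ev : ∀ t ω, evp t ((Z2 ∘ Z1) ω) = Y ⌊t / h⌋₊ ω := fun t ω => rfl
  have hI : ∀ F : PathSp → ℝ, Continuous F → ∫ x, F x ∂(P.map (Z2 ∘ Z1)) = ∫ ω, F ((Z2 ∘ Z1) ω) ∂P :=
    fun F hF => integral_map hZ.aemeasurable hF.aestronglyMeasurable
  have fl : ∀ u t : ℝ, u ≤ t → ⌊u / h⌋₊ + (⌊t / h⌋₊ - ⌊u / h⌋₊) = ⌊t / h⌋₊ := fun u t hut =>
    Nat.add_sub_cancel' (Nat.floor_mono (by gcongr))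
  refine ⟨⟨P.map (Z2 ∘ Z1), Measure.isProbabilityMeasure_map hZ.aemeasurable⟩, ?_⟩
  have cg : ∀ (ι : Type) (τ : ι → ℝ) (g : (ι → ℝ) → ℝ), Continuous g →
      Continuous fun x => g (fun i => evp (τ i) x) :=
    fun ι τ g hg => hg.comp (continuous_pi fun i => cont_evp _)
  have mg : ∀ (ι : Type) [Fintype ι] (τ : ι → ℝ) (u : ℝ), (∀ i, τ i ≤ u) → ∀ (g : (ι → ℝ) → ℝ), Continuous g →
      ∀ B, (∀ y, (∀ i, y i ∈ Icc (0:ℝ) 1) → |g y| ≤ B) →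
      BM (G ⌊u / h⌋₊) fun ω => g (fun i => Y ⌊τ i / h⌋₊ ω) := by
    intro ι _ τ u hτ g hg B hB
    have hm : Measurable[G ⌊u / h⌋₊] (fun ω => fun i : ι => Y ⌊τ i / h⌋₊ ω) :=
      @measurable_pi_lambda _ _ _ (G ⌊u / h⌋₊) _ _ fun i =>
        (hc.bmY (Nat.floor_mono (by have := hτ i; gcongr))).1
    exact ⟨hg.measurable.comp hm, B, fun ω => hB _ fun i => hc.rangeY _ _⟩
  have := cont_bfun s
  have := cont_afun σ
  refine ⟨?_, ?_, ?_, ?_, ?_⟩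
  · show (P.map (Z2 ∘ Z1)).map (evp 0) = α
    rw [Measure.map_map (cont_evp 0).measurable hZ, ← h0]
    congr 1
    funext ω
    show Y ⌊0 / h⌋₊ ω = Y 0 ω
    simp
  · intro u t hut
    show ∫ x, _ ∂(P.map (Z2 ∘ Z1)) ≤ _
    rw [hI (fun x => (evp t x - evp u x) ^ 2) (((cont_evp _).sub (cont_evp _)).pow 2)]
    simp only [ev]
    have := hc.q1 hs hσ hε ⌊u / h⌋₊ (⌊t / h⌋₊ - ⌊u / h⌋₊)
    rwa [fl u t hut] at this
  · intro u t hut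
    show ∫ x, _ ∂(P.map (Z2 ∘ Z1)) ≤ _
    rw [hI (fun x => (evp t x - evp u x) ^ 4) (((cont_evp _).sub (cont_evp _)).pow 4)]
    simp only [ev]
    have := hc.q2 hs hσ hε ⌊u / h⌋₊ (⌊t / h⌋₊ - ⌊u / h⌋₊)
    rwa [fl u t hut] at this
  · intro u t hut ι _ τ hτ g hg B hB0 hB
    show |∫ x, _ ∂(P.map (Z2 ∘ Z1)) - _ * ∫ x, _ ∂(P.map (Z2 ∘ Z1))| ≤ _
    rw [hI (fun x => (evp t x - evp u x) * g (fun i => evp (τ i) x)) (((cont_evp _).sub (cont_evp _)).mul (cg _ _ _ hg)),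
      hI (fun x => bfun s (evp u x) * g (fun i => evp (τ i) x)) (((cont_bfun s).comp (cont_evp _)).mul (cg _ _ _ hg))]
    simp only [ev]
    have := hc.q3 hs hσ hε ⌊u / h⌋₊ (⌊t / h⌋₊ - ⌊u / h⌋₊) (mg ι τ u hτ g hg B hB)
      (fun ω => hB _ fun i => hc.rangeY _ _) hB0
    rwa [fl u t hut] at this
  · intro u t hut ι _ τ hτ g hg B hB0 hB
    show |∫ x, _ ∂(P.map (Z2 ∘ Z1)) - _ * ∫ x, _ ∂(P.map (Z2 ∘ Z1))| ≤ _
    rw [hI (fun x => (evp t x - evp u x) ^ 2 * g (fun i => evp (τ i) x)) ((((cont_evp _).sub (cont_evp _)).pow 2).mul (cg _ _ _ hg)),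
      hI (fun x => afun σ (evp u x) * g (fun i => evp (τ i) x)) (((cont_afun σ).comp (cont_evp _)).mul (cg _ _ _ hg))]
    simp only [ev]
    have := hc.q4 hs hσ hε ⌊u / h⌋₊ (⌊t / h⌋₊ - ⌊u / h⌋₊) (mg ι τ u hτ g hg B hB)
      (fun ω => hB _ fun i => hc.rangeY _ _) hB0
    rwa [fl u t hut] at this

/-- limiting estimates -/
structure WFEst (s σ : ℝ) (α : Measure ℝ) {Ω : Type} [MeasurableSpace Ω] (P : Measure Ω)
    (X : ℝ → Ω → ℝ) (C : ℝ) : Prop where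
  meas : ∀ t, Measurable (X t)
  range : ∀ t ω, X t ω ∈ Icc (0:ℝ) 1
  init : P.map (X 0) = α
  e2 : ∀ u t, 0 ≤ u → u ≤ t → ∫ x, (X t x - X u x) ^ 2 ∂P ≤ C * (t - u)
  e4 : ∀ u t, 0 ≤ u → u ≤ t → ∫ x, (X t x - X u x) ^ 4 ∂P ≤ C * (t - u) ^ 2
  d1 : ∀ u t, 0 ≤ u → u ≤ t → ∀ (ι : Type) [Fintype ι] (τ : ι → ℝ), (∀ i, τ i ≤ u) → ∀ g : (ι → ℝ) → ℝ,
    Continuous g → ∀ B, 0 ≤ B → (∀ y, (∀ i, y i ∈ Icc (0:ℝ) 1) → |g y| ≤ B) →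
    |∫ x, (X t x - X u x) * g (fun i => X (τ i) x) ∂P
      - (t - u) * ∫ x, bfun s (X u x) * g (fun i => X (τ i) x) ∂P|
      ≤ C * B * ((t - u) * √(t - u))
  d2 : ∀ u t, 0 ≤ u → u ≤ t → ∀ (ι : Type) [Fintype ι] (τ : ι → ℝ), (∀ i, τ i ≤ u) → ∀ g : (ι → ℝ) → ℝ,
    Continuous g → ∀ B, 0 ≤ B → (∀ y, (∀ i, y i ∈ Icc (0:ℝ) 1) → |g y| ≤ B) →
    |∫ x, (X t x - X u x) ^ 2 * g (fun i => X (τ i) x) ∂P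
      - (t - u) * ∫ x, afun σ (X u x) * g (fun i => X (τ i) x) ∂P|
      ≤ C * B * ((t - u) * √(t - u))

lemma wgrid_tendsto (h : ℕ → ℝ) (hp : ∀ n, 0 < h n) (h0 : Tendsto h atTop (𝓝 0)) (u t : ℝ) (hu : 0 ≤ u)
    (hut : u ≤ t) : Tendsto (fun n => wgrid (h n) u t) atTop (𝓝 (t - u)) := by
  have key : ∀ v : ℝ, 0 ≤ v → Tendsto (fun n => (⌊v / h n⌋₊ : ℝ) * h n) atTop (𝓝 v) := by
    intro v hv
    refine tendsto_of_tendsto_of_tendsto_of_le_of_le (g := fun n => v - h n) (h := fun _ => v) ?_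
      tendsto_const_nhds ?_ ?_
    · simpa using tendsto_const_nhds.sub h0
    · intro n
      have := Nat.lt_floor_add_one (v / h n)
      rw [div_lt_iff₀ (hp n)] at this
      simp only; linarith
    · intro n
      have := Nat.floor_le (div_nonneg hv (hp n).le)
      rwa [le_div_iff₀ (hp n)] at this
  refine ((key t (hu.trans hut)).sub (key u hu)).congr fun n => ?_
  unfold wgrid
  rw [Nat.cast_sub (Nat.floor_mono (by have := hp n; gcongr)), sub_mul]

lemma exists_est (s σ : ℝ) (hs : 0 < s) (hσ : 0 < σ) (α : Measure ℝ) [IsProbabilityMeasure α]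
    (hα : α (Ioo (0:ℝ) 1)ᶜ = 0) :
    ∃ (P : Measure PathSp) (_ : IsProbabilityMeasure P) (C : ℝ), 0 ≤ C ∧ WFEst s σ α P evp C := by
  obtain ⟨c, hc0, hc1, hc2⟩ : ∃ c : ℝ, 0 < c ∧ c ≤ 1 ∧ s * c ≤ σ ^ 2 := by
    refine ⟨min 1 (σ ^ 2 / s), by positivity, min_le_left _ _, ?_⟩
    calc s * min 1 (σ ^ 2 / s) ≤ s * (σ ^ 2 / s) := by gcongr; exact min_le_right _ _
      _ = σ ^ 2 := by field_simp
  let ε : ℕ → ℝ := fun n => c / (n + 1)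
  have hεp : ∀ n, 0 < ε n := fun n => by positivity
  have hεc : ∀ n, ε n ≤ c := fun n => div_le_self hc0.le (by linarith [Nat.cast_nonneg (α := ℝ) n])
  have hε0 : Tendsto ε atTop (𝓝 0) := by
    have := tendsto_one_div_add_atTop_nhds_zero_nat (𝕜 := ℝ)
    simpa [ε, div_eq_mul_inv] using this.const_mul c
  have hex := fun n => exists_apx s σ hs hσ α hα (ε n) (hεp n) ((hεc n).trans hc1)
    ((mul_le_mul_of_nonneg_left (hεc n) hs.le).trans hc2)
  choose μ hμ using hex
  obtain ⟨Q, -, hQ⟩ := isCompact_univ.exists_mapClusterPt (f := atTop) (u := μ) (by simp)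
  obtain ⟨F, hF, hFQ⟩ := mapClusterPt_iff_ultrafilter.1 hQ
  have hI : ∀ f : PathSp → ℝ, Continuous f →
      Tendsto (fun n => ∫ x, f x ∂(μ n : Measure PathSp)) F (𝓝 (∫ x, f x ∂(Q : Measure PathSp))) := by
    intro f hf
    exact ProbabilityMeasure.tendsto_iff_forall_integral_tendsto.1 hFQ (BoundedContinuousFunction.mkOfCompact ⟨f, hf⟩)
  have hw : ∀ u t, 0 ≤ u → u ≤ t → Tendsto (fun n => wgrid (ε n ^ 2 / σ ^ 2) u t) F (𝓝 (t - u)) := by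
    intro u t hu hut
    refine (wgrid_tendsto (fun n => ε n ^ 2 / σ ^ 2) (fun n => ?_) ?_ u t hu hut).mono_left hF
    · have := hεp n; positivity
    · simpa using (hε0.pow 2).div_const (σ ^ 2)
  have hεF : Tendsto ε F (𝓝 0) := hε0.mono_left hF
  have cg : ∀ (ι : Type) (τ : ι → ℝ) (g : (ι → ℝ) → ℝ), Continuous g →
      Continuous fun x => g (fun i => evp (τ i) x) :=
    fun ι τ g hg => hg.comp (continuous_pi fun i => cont_evp _)
  set K := 3 * s + σ ^ 2 with hK
  have hK0 : 0 ≤ K := by positivity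
  have hsK := Real.sqrt_nonneg K
  refine ⟨Q, inferInstance, K + (15 * s + 11 * σ ^ 2) * K + s * √K + (2 * s + σ ^ 2) * √K, by positivity, ?_⟩
  refine ⟨fun t => (cont_evp t).measurable, evp_mem, ?_, ?_, ?_, ?_, ?_⟩
  · have : IsProbabilityMeasure ((Q : Measure PathSp).map (evp 0)) :=
      Measure.isProbabilityMeasure_map (cont_evp 0).measurable.aemeasurable
    refine ext_of_forall_integral_eq_of_IsFiniteMeasure fun f => ?_
    rw [integral_map (cont_evp 0).measurable.aemeasurable f.continuous.aestronglyMeasurable]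
    refine tendsto_nhds_unique (hI _ (f.continuous.comp (cont_evp 0))) ?_
    refine tendsto_const_nhds.congr fun n => ?_
    rw [← (hμ n).init, integral_map (cont_evp 0).measurable.aemeasurable f.continuous.aestronglyMeasurable]
  · intro u t hu hut
    have hut' : 0 ≤ t - u := by linarith
    have h1 := le_of_tendsto_of_tendsto' (hI _ (((cont_evp t).sub (cont_evp u)).pow 2))
      ((hw u t hu hut).const_mul K) fun n => (hμ n).e2 u t hut
    refine h1.trans (mul_le_mul_of_nonneg_right ?_ hut')
    have : 0 ≤ (15 * s + 11 * σ ^ 2) * K + s * √K + (2 * s + σ ^ 2) * √K := by positivity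
    linarith
  · intro u t hu hut
    have hut' : 0 ≤ t - u := by linarith
    have hw' := hw u t hu hut
    have h1 := le_of_tendsto_of_tendsto' (hI _ (((cont_evp t).sub (cont_evp u)).pow 4))
      (hw'.mul (((hw'.const_mul K).add (hεF.pow 2)).const_mul (15 * s + 11 * σ ^ 2))) fun n => (hμ n).e4 u t hut
    refine h1.trans ?_
    have : 0 ≤ K + s * √K + (2 * s + σ ^ 2) * √K := by positivity
    have : (K + (15 * s + 11 * σ ^ 2) * K + s * √K + (2 * s + σ ^ 2) * √K) * (t - u) ^ 2
      = (t - u) * ((15 * s + 11 * σ ^ 2) * (K * (t - u) + 0 ^ 2)) + (K + s * √K + (2 * s + σ ^ 2) * √K) * (t - u) ^ 2 := by ring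
    rw [this]
    have : 0 ≤ (K + s * √K + (2 * s + σ ^ 2) * √K) * (t - u) ^ 2 := by positivity
    linarith
  · intro u t hu hut ι _ τ hτ g hg B hB0 hB
    have hut' : 0 ≤ t - u := by linarith
    have hw' := hw u t hu hut
    have h1 := le_of_tendsto_of_tendsto' (((hI _ (((cont_evp t).sub (cont_evp u)).mul (cg _ τ _ hg))).sub
      (hw'.mul (hI _ (((cont_bfun s).comp (cont_evp u)).mul (cg _ τ _ hg))))).abs)
      (hw'.mul ((hw'.const_mul K).sqrt.const_mul (s * B))) fun n => (hμ n).d1 u t hut ι τ hτ g hg B hB0 hB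
    refine h1.trans ?_
    rw [Real.sqrt_mul hK0]
    have : 0 ≤ (K + (15 * s + 11 * σ ^ 2) * K + (2 * s + σ ^ 2) * √K) * B * ((t - u) * √(t - u)) := by
      positivity
    nlinarith
  · intro u t hu hut ι _ τ hτ g hg B hB0 hB
    have hut' : 0 ≤ t - u := by linarith
    have hw' := hw u t hu hut
    have h1 := le_of_tendsto_of_tendsto' (((hI _ ((((cont_evp t).sub (cont_evp u)).pow 2).mul (cg _ τ _ hg))).sub
      (hw'.mul (hI _ (((cont_afun σ).comp (cont_evp u)).mul (cg _ τ _ hg))))).abs)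
      (hw'.mul (((hw'.const_mul K).sqrt.const_mul ((2 * s + σ ^ 2) * B)).add ((hεF.const_mul s).mul_const B)))
      fun n => (hμ n).d2 u t hut ι τ hτ g hg B hB0 hB
    refine h1.trans ?_
    rw [Real.sqrt_mul hK0]
    have : 0 ≤ (K + (15 * s + 11 * σ ^ 2) * K + s * √K) * B * ((t - u) * √(t - u)) := by
      positivity
    nlinarith

end WFX

namespace WFX

/-- dyadic floor -/
def dy (n : ℕ) (t : ℝ) : ℝ := (⌊2 ^ n * t⌋₊ : ℝ) / 2 ^ n

/-- dyadic Hölder control -/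
def GoodP (x : ℝ → ℝ) : Prop := ∀ N : ℕ, ∃ A : ℕ, ∀ n k : ℕ, k < N * 2 ^ n →
  |x (((k + 1 : ℕ) : ℝ) / 2 ^ n) - x ((k : ℝ) / 2 ^ n)| ≤ A * (19 / 20) ^ n

lemma dy_step {x : ℝ → ℝ} {N A : ℕ} (hA : ∀ n k : ℕ, k < N * 2 ^ n →
    |x (((k + 1 : ℕ) : ℝ) / 2 ^ n) - x ((k : ℝ) / 2 ^ n)| ≤ A * (19 / 20) ^ n) {t : ℝ} (ht : t < N)
    (hN : 0 < N) (n : ℕ) : |x (dy (n+1) t) - x (dy n t)| ≤ A * (19 / 20) ^ n := by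
  have hA0 : (0:ℝ) ≤ A * (19/20) ^ n := by positivity
  rcases le_or_gt t 0 with h0 | h0
  · have : ∀ n, dy n t = 0 := fun n => by
      unfold dy
      rw [Nat.floor_of_nonpos (mul_nonpos_of_nonneg_of_nonpos (by positivity) h0)]; simp
    simp only [this, sub_self, abs_zero]; exact hA0
  set k := ⌊2 ^ n * t⌋₊ with hk
  have hk1 : (k:ℝ) ≤ 2 ^ n * t := Nat.floor_le (by positivity)
  have hk2 : 2 ^ n * t < k + 1 := Nat.lt_floor_add_one _
  set j := ⌊2 ^ (n+1) * t⌋₊ with hj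
  have hj1 : (j:ℝ) ≤ 2 ^ (n+1) * t := Nat.floor_le (by positivity)
  have hj2 : 2 ^ (n+1) * t < j + 1 := Nat.lt_floor_add_one _
  have hp : (2:ℝ) ^ (n+1) = 2 * 2 ^ n := by ring
  have l1 : 2 * k ≤ j := by
    have : (2 * k : ℝ) < j + 1 := by nlinarith
    have : 2 * k < j + 1 := by exact_mod_cast this
    omega
  have l2 : j ≤ 2 * k + 1 := by
    have : (j : ℝ) < 2 * k + 2 := by nlinarith
    have : j < 2 * k + 2 := by exact_mod_cast this
    omega
  have ek : dy n t = ((2 * k : ℕ) : ℝ) / 2 ^ (n+1) := by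
    unfold dy; rw [← hk, hp]; push_cast
    rw [mul_div_mul_left _ _ two_ne_zero]
  have ej : dy (n+1) t = (j : ℝ) / 2 ^ (n+1) := rfl
  rw [ek, ej]
  rcases (by omega : j = 2 * k ∨ j = 2 * k + 1) with h | h
  · rw [h, sub_self, abs_zero]; exact hA0
  · rw [h]
    refine (hA (n+1) (2 * k) ?_).trans ?_
    · have : (2 * k : ℝ) < N * 2 ^ (n+1) := by
        have : (2:ℝ) ^ n * t < 2 ^ n * N := by gcongr
        nlinarith
      exact_mod_cast this
    · gcongr (A:ℝ) * ?_
      exact pow_le_pow_of_le_one (by norm_num) (by norm_num) (Nat.le_succ n)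

lemma dy_osc {x : ℝ → ℝ} {N A : ℕ} (hA : ∀ n k : ℕ, k < N * 2 ^ n →
    |x (((k + 1 : ℕ) : ℝ) / 2 ^ n) - x ((k : ℝ) / 2 ^ n)| ≤ A * (19 / 20) ^ n) {s t : ℝ} (ht : t < N)
    (hN : 0 < N) (n : ℕ) (hst : s ≤ t) (hn : t - s < 1 / 2 ^ n) :
    |x (dy n t) - x (dy n s)| ≤ A * (19 / 20) ^ n := by
  have hA0 : (0:ℝ) ≤ A * (19/20) ^ n := by positivity
  have hp : (0:ℝ) < 2 ^ n := by positivity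
  rw [lt_div_iff₀ hp] at hn
  set k := ⌊2 ^ n * s⌋₊ with hk
  set j := ⌊2 ^ n * t⌋₊ with hj
  have l1 : k ≤ j := Nat.floor_mono (by gcongr)
  have hk2 : 2 ^ n * s < k + 1 := Nat.lt_floor_add_one _
  have l2 : j ≤ k + 1 := by
    rw [hj]
    have : 2 ^ n * t < ((k + 2 : ℕ) : ℝ) := by push_cast; nlinarith
    have := (Nat.floor_lt' (by omega : k + 2 ≠ 0)).2 this
    omega
  have es : dy n s = (k : ℝ) / 2 ^ n := rfl
  have et : dy n t = (j : ℝ) / 2 ^ n := rfl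
  rw [es, et]
  rcases (by omega : j = k ∨ j = k + 1) with h | h
  · rw [h, sub_self, abs_zero]; exact hA0
  · rw [h]
    refine hA n k ?_
    have hj0 : 0 < j := by omega
    have hj1 : (j:ℝ) ≤ 2 ^ n * t := by
      rw [hj] at hj0
      exact Nat.floor_le (le_trans zero_le_one (Nat.floor_pos.1 hj0))
    have : (k:ℝ) < N * 2 ^ n := by
      have h1 : (2:ℝ) ^ n * t < 2 ^ n * N := by gcongr
      have : (j:ℝ) = k + 1 := by rw [h]; push_cast; ring
      nlinarith
    exact_mod_cast this

lemma good_lim {x : ℝ → ℝ} (hx : GoodP x) (t : ℝ) : ∃ l, Tendsto (fun n => x (dy n t)) atTop (𝓝 l) := by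
  obtain ⟨N, hN⟩ := exists_nat_gt (max t 0)
  obtain ⟨A, hA⟩ := hx N
  have hN0 : 0 < N := by exact_mod_cast (le_max_right t 0).trans_lt hN
  refine cauchySeq_tendsto_of_complete (cauchySeq_of_le_geometric (19/20) A (by norm_num) fun n => ?_)
  rw [dist_comm, Real.dist_eq]
  exact dy_step hA ((le_max_left t 0).trans_lt hN) hN0 n

lemma good_cont {x y : ℝ → ℝ} (hx : GoodP x) (hy : ∀ t, Tendsto (fun n => x (dy n t)) atTop (𝓝 (y t))) :
    Continuous y := by
  rw [continuous_iff_continuousAt]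
  intro t
  obtain ⟨N, hN⟩ := exists_nat_gt (max (t + 1) 0)
  obtain ⟨A, hA⟩ := hx N
  have hN0 : 0 < N := by exact_mod_cast (le_max_right (t+1) 0).trans_lt hN
  have hN1 : t + 1 < N := (le_max_left (t+1) 0).trans_lt hN
  have key : ∀ u v : ℝ, u ≤ v → v < t + 1 → ∀ n : ℕ, v - u < 1 / 2 ^ n → |y v - y u| ≤ (41 * A) * (19/20) ^ n := by
    intro u v huv hv n hn
    have hd : ∀ w : ℝ, w < N → |x (dy n w) - y w| ≤ 20 * A * (19/20) ^ n := by
      intro w hw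
      have := dist_le_of_le_geometric_of_tendsto (19/20) A (by norm_num) (f := fun n => x (dy n w)) (a := y w)
        (fun n => by rw [dist_comm, Real.dist_eq]; exact dy_step hA hw hN0 n) (hy w) n
      rw [Real.dist_eq] at this
      refine this.trans (le_of_eq ?_)
      ring
    have h1 := hd v (by linarith)
    have h2 := hd u (by linarith)
    have h3 := dy_osc hA (by linarith) hN0 n huv hn
    rw [abs_le] at *
    constructor <;> linarith [h1.1, h1.2, h2.1, h2.2, h3.1, h3.2]
  rw [Metric.continuousAt_iff]
  intro e he
  have hlim : Tendsto (fun n : ℕ => (41 * A : ℝ) * (19/20) ^ n) atTop (𝓝 0) := by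
    simpa using (tendsto_pow_atTop_nhds_zero_of_lt_one (by norm_num : (0:ℝ) ≤ 19/20) (by norm_num)).const_mul (41 * A : ℝ)
  obtain ⟨n, hn⟩ := (hlim.eventually (gt_mem_nhds he)).exists
  refine ⟨min 1 (1 / 2 ^ n), by positivity, fun {u} hu => ?_⟩
  rw [Real.dist_eq] at hu ⊢
  have hu1 := hu.trans_le (min_le_left _ _)
  have hu2 := hu.trans_le (min_le_right _ _)
  rw [abs_lt] at hu1 hu2
  refine lt_of_le_of_lt ?_ hn
  rcases le_total u t with h | h
  · rw [abs_sub_comm]; exact key u t h (by linarith) n (by linarith)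
  · exact key t u h (by linarith) n (by linarith)

lemma ae_summable {Ω : Type} [MeasurableSpace Ω] {P : Measure Ω} (F : ℕ → Ω → ℝ)
    (h0 : ∀ n ω, 0 ≤ F n ω) (hi : ∀ n, Integrable (F n) P) (hm : ∀ n, Measurable (F n)) (c : ℕ → ℝ)
    (hc : ∀ n, ∫ ω, F n ω ∂P ≤ c n) (hs : Summable c) : ∀ᵐ ω ∂P, Summable fun n => F n ω := by
  have h1 : ∫⁻ ω, ∑' n, ENNReal.ofReal (F n ω) ∂P ≠ ⊤ := by
    rw [lintegral_tsum fun n => (hm n).ennreal_ofReal.aemeasurable]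
    refine ne_top_of_le_ne_top ?_ (ENNReal.tsum_le_tsum (g := fun n => ENNReal.ofReal (c n)) fun n => ?_)
    · exact hs.tsum_ofReal_ne_top
    · rw [← ofReal_integral_eq_lintegral_ofReal (hi n) (ae_of_all _ (h0 n))]
      exact ENNReal.ofReal_le_ofReal (hc n)
  have h2 := ae_lt_top' (AEMeasurable.ennreal_tsum fun n => (hm n).ennreal_ofReal.aemeasurable) h1
  filter_upwards [h2] with ω hω
  have := ENNReal.summable_toReal hω.ne
  simpa [ENNReal.toReal_ofReal (h0 _ ω)] using this

section kc
variable {Ω : Type} [m : MeasurableSpace Ω] {P : Measure Ω} [IsProbabilityMeasure P] {X : ℝ → Ω → ℝ} {C : ℝ}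

lemma ae_good (hm : ∀ t, Measurable (X t)) (hr : ∀ t ω, X t ω ∈ Icc (0:ℝ) 1)
    (h4 : ∀ u t, 0 ≤ u → u ≤ t → ∫ x, (X t x - X u x) ^ 4 ∂P ≤ C * (t - u) ^ 2) :
    ∀ᵐ ω ∂P, GoodP fun t => X t ω := by
  unfold GoodP
  rw [ae_all_iff]
  intro N
  have hb : ∀ t u, BM m (fun ω => (X t ω - X u ω) ^ 4) := fun t u =>
    ((BM.of01 (hm t) (hr t)).sub (BM.of01 (hm u) (hr u))).pow 4
  let F : ℕ → Ω → ℝ := fun n ω => (3/2) ^ n * ∑ k ∈ Finset.range (N * 2 ^ n),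
    (X (((k + 1 : ℕ) : ℝ) / 2 ^ n) ω - X ((k : ℝ) / 2 ^ n) ω) ^ 4
  have hFi : ∀ n, Integrable (F n) P := fun n =>
    (integrable_finsetSum _ fun k _ => (hb _ _).int P).const_mul _
  have hFm : ∀ n, Measurable (F n) := fun n =>
    (Finset.measurable_fun_sum _ fun k _ => (hb _ _).1).const_mul _
  have hF0 : ∀ n ω, 0 ≤ F n ω := fun n ω =>
    mul_nonneg (by positivity) (Finset.sum_nonneg fun k _ => by positivity)
  have hc : ∀ n, ∫ ω, F n ω ∂P ≤ N * C * (3/4) ^ n := by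
    intro n
    simp only [F]
    rw [integral_const_mul, integral_finsetSum _ fun k _ => (hb _ _).int P]
    have : ∀ k ∈ Finset.range (N * 2 ^ n), ∫ ω, (X (((k + 1 : ℕ) : ℝ) / 2 ^ n) ω - X ((k : ℝ) / 2 ^ n) ω) ^ 4 ∂P
        ≤ C * (1 / 2 ^ n) ^ 2 := by
      intro k _
      have := h4 ((k : ℝ) / 2 ^ n) (((k + 1 : ℕ) : ℝ) / 2 ^ n) (by positivity) (by push_cast; gcongr; linarith)
      refine this.trans (le_of_eq ?_)
      congr 2
      push_cast; ring
    have := Finset.sum_le_sum this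
    rw [Finset.sum_const, Finset.card_range, nsmul_eq_mul] at this
    push_cast at this
    calc _ ≤ (3/2 : ℝ) ^ n * (N * 2 ^ n * (C * (1 / 2 ^ n) ^ 2)) := mul_le_mul_of_nonneg_left (by simpa using this) (by positivity)
      _ = N * C * (3/4) ^ n := by
        have : (3/4 : ℝ) ^ n = (3/2) ^ n * (1 / 2 ^ n) := by rw [← one_div_pow, ← mul_pow]; norm_num
        rw [this]
        field_simp
  have := ae_summable F hF0 hFi hFm _ hc ((summable_geometric_of_lt_one (by norm_num) (by norm_num)).mul_left _)
  filter_upwards [this] with ω hω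
  obtain ⟨A, hA⟩ := exists_nat_ge (max 1 (∑' n, F n ω))
  refine ⟨A, fun n k hk => ?_⟩
  have hA1 : (1:ℝ) ≤ A := (le_max_left _ _).trans hA
  have hA2 : ∑' n, F n ω ≤ A := (le_max_right _ _).trans hA
  have h1 : F n ω ≤ A := (hω.le_tsum n fun j _ => hF0 j ω).trans hA2
  have h2 : (X (((k + 1 : ℕ) : ℝ) / 2 ^ n) ω - X ((k : ℝ) / 2 ^ n) ω) ^ 4 ≤ ∑ k ∈ Finset.range (N * 2 ^ n),
    (X (((k + 1 : ℕ) : ℝ) / 2 ^ n) ω - X ((k : ℝ) / 2 ^ n) ω) ^ 4 :=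
    Finset.single_le_sum (f := fun k : ℕ => (X (((k + 1 : ℕ) : ℝ) / 2 ^ n) ω - X ((k : ℝ) / 2 ^ n) ω) ^ 4)
      (fun k _ => by positivity) (Finset.mem_range.2 hk)
  set S := ∑ k ∈ Finset.range (N * 2 ^ n),
    (X (((k + 1 : ℕ) : ℝ) / 2 ^ n) ω - X ((k : ℝ) / 2 ^ n) ω) ^ 4 with hS
  have h3 : (3/2 : ℝ) ^ n * S ≤ A := h1
  have h4 : S ≤ A * (2/3) ^ n := by
    have : (3/2 : ℝ) ^ n * (2/3) ^ n = 1 := by rw [← mul_pow]; norm_num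
    have hp : (0:ℝ) ≤ (2/3) ^ n := by positivity
    calc S = ((3/2 : ℝ) ^ n * S) * (2/3) ^ n := by rw [mul_right_comm, this, one_mul]
      _ ≤ _ := by gcongr
  have h5 : (2/3 : ℝ) ^ n ≤ ((19/20) ^ n) ^ 4 := by
    rw [← pow_mul, mul_comm n 4, pow_mul]
    gcongr; norm_num
  have h6 : (A : ℝ) ≤ A ^ 4 := le_self_pow₀ hA1 (by norm_num)
  refine (pow_le_pow_iff_left₀ (abs_nonneg _) (by positivity) (by norm_num : 4 ≠ 0)).1 ?_
  have e4 : |X (((k + 1 : ℕ) : ℝ) / 2 ^ n) ω - X ((k : ℝ) / 2 ^ n) ω| ^ 4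
    = (X (((k + 1 : ℕ) : ℝ) / 2 ^ n) ω - X ((k : ℝ) / 2 ^ n) ω) ^ 4 := Even.pow_abs (by decide) _
  rw [e4, mul_pow]
  calc _ ≤ S := h2
    _ ≤ A * (2/3) ^ n := h4
    _ ≤ _ := by gcongr

lemma ae_dy (hm : ∀ t, Measurable (X t)) (hr : ∀ t ω, X t ω ∈ Icc (0:ℝ) 1) (hC : 0 ≤ C)
    (h4 : ∀ u t, 0 ≤ u → u ≤ t → ∫ x, (X t x - X u x) ^ 4 ∂P ≤ C * (t - u) ^ 2) (t : ℝ) (ht : 0 ≤ t) :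
    ∀ᵐ ω ∂P, Tendsto (fun n => X (dy n t) ω) atTop (𝓝 (X t ω)) := by
  have hb : ∀ t u, BM m (fun ω => (X t ω - X u ω) ^ 4) := fun t u =>
    ((BM.of01 (hm t) (hr t)).sub (BM.of01 (hm u) (hr u))).pow 4
  have := ae_summable (P := P) (fun n ω => (X t ω - X (dy n t) ω) ^ 4) (fun n ω => by positivity) (fun n => (hb _ _).int P)
    (fun n => (hb _ _).1) (fun n => C * (1/2) ^ n) (fun n => ?_)
    ((summable_geometric_of_lt_one (by norm_num) (by norm_num)).mul_left _)
  · filter_upwards [this] with ω hω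
    have h1 := hω.tendsto_atTop_zero
    rw [tendsto_iff_norm_sub_tendsto_zero]
    have h2 := (h1.sqrt).sqrt
    simp only [Real.sqrt_zero] at h2
    refine h2.congr fun n => ?_
    have : (X t ω - X (dy n t) ω) ^ 4 = ((X t ω - X (dy n t) ω) ^ 2) ^ 2 := by ring
    rw [this, Real.sqrt_sq (sq_nonneg _), Real.sqrt_sq_eq_abs, abs_sub_comm, Real.norm_eq_abs]
  · have hp : (0:ℝ) < 2 ^ n := by positivity
    have h1 : dy n t ≤ t := by
      unfold dy; rw [div_le_iff₀ hp, mul_comm t]; exact Nat.floor_le (by positivity)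
    have h2 : t - dy n t ≤ (1/2) ^ n := by
      have := Nat.lt_floor_add_one (2 ^ n * t)
      have e : (1/2 : ℝ) ^ n = 1 / 2 ^ n := by rw [one_div_pow]
      rw [e, le_div_iff₀ hp, sub_mul]
      unfold dy; rw [div_mul_cancel₀ _ hp.ne']; linarith
    refine (h4 (dy n t) t (by unfold dy; positivity) h1).trans ?_
    gcongr
    have h3 : 0 ≤ t - dy n t := by linarith
    have h5 : (1/2 : ℝ) ^ n ≤ 1 := pow_le_one₀ (by norm_num) (by norm_num)
    nlinarith

lemma exists_cont (hm : ∀ t, Measurable (X t)) (hr : ∀ t ω, X t ω ∈ Icc (0:ℝ) 1) (hC : 0 ≤ C)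
    (h4 : ∀ u t, 0 ≤ u → u ≤ t → ∫ x, (X t x - X u x) ^ 4 ∂P ≤ C * (t - u) ^ 2) :
    ∃ Z : ℝ → Ω → ℝ, (∀ t, Measurable (Z t)) ∧ (∀ t ω, Z t ω ∈ Icc (0:ℝ) 1) ∧
      (∀ ω, Continuous fun t => Z t ω) ∧ (∀ t, Z t = Z (max t 0)) ∧
      ∀ t, 0 ≤ t → Z t =ᵐ[P] X t := by
  have hG : MeasurableSet {ω | GoodP fun t => X t ω} := by
    unfold GoodP
    simp only [setOf_forall, setOf_exists]
    refine MeasurableSet.iInter fun N => MeasurableSet.iUnion fun A => MeasurableSet.iInter fun n =>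
      MeasurableSet.iInter fun k => MeasurableSet.iInter fun _ => ?_
    exact measurableSet_le ((hm _).sub (hm _)).abs measurable_const
  let F : ℕ → ℝ → Ω → ℝ := fun n t => {ω | GoodP fun t => X t ω}.indicator (X (dy n t))
  have hl : ∀ t ω, ∃ l, Tendsto (fun n => F n t ω) atTop (𝓝 l) := by
    intro t ω
    by_cases h : ω ∈ {ω | GoodP fun t => X t ω}
    · simp only [F, indicator_of_mem h]; exact good_lim (x := fun t => X t ω) h t
    · simp only [F, indicator_of_notMem h]; exact ⟨0, tendsto_const_nhds⟩
  choose Z hZ using hl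
  have hFm : ∀ n t, Measurable (F n t) := fun n t => (hm _).indicator hG
  have hF01 : ∀ n t ω, F n t ω ∈ Icc (0:ℝ) 1 := by
    intro n t ω
    by_cases h : ω ∈ {ω | GoodP fun t => X t ω}
    · simp only [F, indicator_of_mem h]; exact hr _ _
    · simp only [F, indicator_of_notMem h]; exact ⟨le_rfl, zero_le_one⟩
  refine ⟨Z, ?_, ?_, ?_, ?_, ?_⟩
  · exact fun t => measurable_of_tendsto_metrizable (fun n => hFm n t) (tendsto_pi_nhds.2 fun ω => hZ t ω)
  · exact fun t ω => isClosed_Icc.mem_of_tendsto (hZ t ω) (Eventually.of_forall fun n => hF01 n t ω)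
  · intro ω
    by_cases h : ω ∈ {ω | GoodP fun t => X t ω}
    · refine good_cont (x := fun t => X t ω) h fun t => ?_
      have := hZ t ω
      simpa only [F, indicator_of_mem h] using this
    · have : ∀ t, Z t ω = 0 := fun t => by
        have := hZ t ω
        simp only [F, indicator_of_notMem h] at this
        exact tendsto_nhds_unique this tendsto_const_nhds
      simp only [this]; exact continuous_const
  · intro t
    funext ω
    refine tendsto_nhds_unique (hZ t ω) ((hZ _ ω).congr fun n => ?_)
    rcases le_total 0 t with h | h
    · rw [max_eq_left h]
    · have : dy n (max t 0) = dy n t := by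
        unfold dy
        rw [max_eq_right h, Nat.floor_of_nonpos (mul_nonpos_of_nonneg_of_nonpos (by positivity) h)]; simp
      simp only [F, this]
  · intro t ht
    filter_upwards [ae_good hm hr h4, ae_dy hm hr hC h4 t ht] with ω h1 h2
    have := hZ t ω
    have h1' : ω ∈ {ω | GoodP fun t => X t ω} := h1
    simp only [F, indicator_of_mem h1'] at this
    exact tendsto_nhds_unique this h2

end kc

/-- continuous realisation on path space -/
lemma exists_est_cont (s σ : ℝ) (hs : 0 < s) (hσ : 0 < σ) (α : Measure ℝ) [IsProbabilityMeasure α]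
    (hα : α (Ioo (0:ℝ) 1)ᶜ = 0) :
    ∃ (P : Measure PathSp) (_ : IsProbabilityMeasure P) (X : ℝ → PathSp → ℝ) (C : ℝ),
      0 ≤ C ∧ WFEst s σ α P X C ∧ (∀ ω, Continuous fun t => X t ω) ∧ ∀ t, X t = X (max t 0) := by
  obtain ⟨P, hP, C, hC, hE⟩ := exists_est s σ hs hσ α hα
  obtain ⟨Z, z1, z2, z3, z4, z5⟩ := exists_cont hE.meas hE.range hC hE.e4
  refine ⟨P, hP, Z, C, hC, ⟨z1, z2, ?_, ?_, ?_, ?_, ?_⟩, z3, z4⟩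
  · rw [← hE.init]; exact Measure.map_congr (z5 0 le_rfl)
  · intro u t hu hut
    refine le_of_eq_of_le (integral_congr_ae ?_) (hE.e2 u t hu hut)
    filter_upwards [z5 u hu, z5 t (hu.trans hut)] with ω h1 h2
    rw [h1, h2]
  · intro u t hu hut
    refine le_of_eq_of_le (integral_congr_ae ?_) (hE.e4 u t hu hut)
    filter_upwards [z5 u hu, z5 t (hu.trans hut)] with ω h1 h2
    rw [h1, h2]
  · intro u t hu hut ι _ τ hτ g hg B hB0 hB
    have ha : ∀ᵐ ω ∂P, ∀ i, Z (τ i) ω = evp (max (τ i) 0) ω := by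
      rw [ae_all_iff]; intro i; rw [z4]; exact z5 _ (le_max_right _ _)
    have := hE.d1 u t hu hut ι (fun i => max (τ i) 0) (fun i => max_le (hτ i) hu) g hg B hB0 hB
    refine le_of_eq_of_le ?_ this
    congr 2
    · refine integral_congr_ae ?_
      filter_upwards [z5 u hu, z5 t (hu.trans hut), ha] with ω h1 h2 h3
      simp only [h1, h2, h3]
    · congr 1
      refine integral_congr_ae ?_
      filter_upwards [z5 u hu, ha] with ω h1 h3
      simp only [h1, h3]
  · intro u t hu hut ι _ τ hτ g hg B hB0 hB
    have ha : ∀ᵐ ω ∂P, ∀ i, Z (τ i) ω = evp (max (τ i) 0) ω := by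
      rw [ae_all_iff]; intro i; rw [z4]; exact z5 _ (le_max_right _ _)
    have := hE.d2 u t hu hut ι (fun i => max (τ i) 0) (fun i => max_le (hτ i) hu) g hg B hB0 hB
    refine le_of_eq_of_le ?_ this
    congr 2
    · refine integral_congr_ae ?_
      filter_upwards [z5 u hu, z5 t (hu.trans hut), ha] with ω h1 h2 h3
      simp only [h1, h2, h3]
    · congr 1
      refine integral_congr_ae ?_
      filter_upwards [z5 u hu, ha] with ω h1 h3
      simp only [h1, h3]

end WFX

namespace WFX

lemma taylor (f : ℝ → ℝ) (hf : ContDiff ℝ 2 f) (η : ℝ) (hη : 0 < η) :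
    ∃ K, 0 ≤ K ∧ ∀ x ∈ Icc (0:ℝ) 1, ∀ y ∈ Icc (0:ℝ) 1,
      |f y - f x - deriv f x * (y - x) - 1 / 2 * deriv (deriv f) x * (y - x) ^ 2|
        ≤ (η + K * (y - x) ^ 2) * (y - x) ^ 2 := by
  have h1 : Differentiable ℝ f := hf.differentiable (by norm_num)
  have hf1 : ContDiff ℝ 1 (deriv f) := by
    have : ContDiff ℝ (1 + 1) f := by simpa [one_add_one_eq_two] using hf
    exact (contDiff_succ_iff_deriv.1 this).2.2
  have h2 : Differentiable ℝ (deriv f) := hf1.differentiable (by norm_num)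
  have h3 : Continuous (deriv (deriv f)) := hf1.continuous_deriv le_rfl
  set f1 := deriv f
  set f2 := deriv f1
  obtain ⟨B, hB⟩ := (isCompact_Icc (a := (0:ℝ)) (b := 1)).exists_bound_of_continuousOn h3.continuousOn
  have huc := (isCompact_Icc (a := (0:ℝ)) (b := 1)).uniformContinuousOn_of_continuous h3.continuousOn
  rw [Metric.uniformContinuousOn_iff] at huc
  obtain ⟨δ, hδ, hu⟩ := huc η hη
  have hB0 : 0 ≤ B := (norm_nonneg _).trans (hB 0 (by simp))
  refine ⟨2 * B / δ ^ 2, by positivity, fun x hx z hz => ?_⟩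
  set K := 2 * B / δ ^ 2 with hK
  have hK0 : 0 ≤ K := by positivity
  set ε := η + K * (z - x) ^ 2 with hε
  have hε0 : 0 ≤ ε := by positivity
  have hsub : uIcc x z ⊆ Icc (0:ℝ) 1 := by
    intro y hy
    rw [mem_uIcc] at hy
    rcases hy with h | h
    · exact ⟨hx.1.trans h.1, h.2.trans hz.2⟩
    · exact ⟨hz.1.trans h.1, h.2.trans hx.2⟩
  have habs : ∀ y ∈ uIcc x z, |y - x| ≤ |z - x| := fun y hy => abs_sub_left_of_mem_uIcc hy
  have hconv : Convex ℝ (uIcc x z) := convex_uIcc x z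
  have b2 : ∀ y ∈ uIcc x z, |f2 y - f2 x| ≤ ε := by
    intro y hy
    by_cases hd : |y - x| < δ
    · have := hu y (hsub hy) x hx (by rwa [Real.dist_eq])
      rw [Real.dist_eq] at this
      have : 0 ≤ K * (z - x) ^ 2 := by positivity
      linarith
    · push Not at hd
      have h5 : δ ^ 2 ≤ (z - x) ^ 2 := by
        rw [← sq_abs (z - x)]; exact pow_le_pow_left₀ hδ.le (hd.trans (habs y hy)) 2
      have h6 : 2 * B ≤ K * (z - x) ^ 2 := by
        rw [hK, div_mul_eq_mul_div, le_div_iff₀ (by positivity)]; gcongr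
      have h7 := hB y (hsub hy)
      have h8 := hB x hx
      rw [Real.norm_eq_abs] at h7 h8
      linarith [abs_sub (f2 y) (f2 x)]
  have b1 : ∀ y ∈ uIcc x z, |f1 y - f1 x - f2 x * (y - x)| ≤ ε * |z - x| := by
    intro y hy
    have := hconv.norm_image_sub_le_of_norm_hasDerivWithin_le (f := fun y => f1 y - f2 x * (y - x))
      (f' := fun y => f2 y - f2 x) (C := ε) (x := x) (y := y) (fun y _ => by
        have := (h2 y).hasDerivAt.sub (((hasDerivAt_id y).sub_const x).const_mul (f2 x))
        refine HasDerivAt.hasDerivWithinAt ?_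
        refine this.congr_deriv ?_
        ring) b2 left_mem_uIcc hy
    simp only [sub_self, mul_zero, sub_zero, Real.norm_eq_abs] at this
    calc _ = |f1 y - f2 x * (y - x) - f1 x| := by congr 1; ring
      _ ≤ _ := this
      _ ≤ _ := mul_le_mul_of_nonneg_left (habs y hy) hε0
  have := hconv.norm_image_sub_le_of_norm_hasDerivWithin_le
      (f := fun y => f y - f1 x * (y - x) - 1 / 2 * f2 x * (y - x) ^ 2)
      (f' := fun y => f1 y - f1 x - f2 x * (y - x)) (C := ε * |z - x|) (x := x) (y := z) (fun y _ => by
        have := ((h1 y).hasDerivAt.sub (((hasDerivAt_id y).sub_const x).const_mul (f1 x))).sub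
          ((((hasDerivAt_id y).sub_const x).pow 2).const_mul (1 / 2 * f2 x))
        refine HasDerivAt.hasDerivWithinAt ?_
        refine this.congr_deriv ?_
        simp only [id]
        push_cast
        ring) b1 left_mem_uIcc right_mem_uIcc
  simp only [sub_self, mul_zero, sub_zero, Real.norm_eq_abs] at this
  calc _ = |f z - f1 x * (z - x) - 1 / 2 * f2 x * (z - x) ^ 2 - (f x - 1 / 2 * f2 x * 0 ^ 2)| := by
        congr 1; ring
    _ ≤ ε * |z - x| * |z - x| := this
    _ = _ := by rw [mul_assoc, ← sq, sq_abs]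

lemma LWF_eq (s σ : ℝ) (f : ℝ → ℝ) (x : ℝ) :
    LWF s σ f x = bfun s x * deriv f x + 1 / 2 * (afun σ x * deriv (deriv f) x) := by
  unfold LWF bfun afun; ring

lemma cont_d1 {f : ℝ → ℝ} (hf : ContDiff ℝ 2 f) : Continuous (deriv f) :=
  hf.continuous_deriv (by norm_num)

lemma cont_d2 {f : ℝ → ℝ} (hf : ContDiff ℝ 2 f) : Continuous (deriv (deriv f)) := by
  have : ContDiff ℝ (1 + 1) f := by simpa [one_add_one_eq_two] using hf
  exact (contDiff_succ_iff_deriv.1 this).2.2.continuous_deriv le_rfl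

lemma cont_LWF {s σ : ℝ} {f : ℝ → ℝ} (hf : ContDiff ℝ 2 f) : Continuous (LWF s σ f) := by
  have := cont_d1 hf
  have := cont_d2 hf
  unfold LWF; fun_prop

lemma BM_cyl {Ω : Type} [m : MeasurableSpace Ω] {X : ℝ → Ω → ℝ} (hm : ∀ t, Measurable (X t))
    (hr : ∀ t ω, X t ω ∈ Icc (0:ℝ) 1)
    {ι : Type} [Fintype ι] (τ : ι → ℝ) {g : (ι → ℝ) → ℝ} (hg : Continuous g) {B : ℝ}
    (hB : ∀ y, (∀ i, y i ∈ Icc (0:ℝ) 1) → |g y| ≤ B) : BM m (fun ω => g (fun i => X (τ i) ω)) :=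
  ⟨hg.measurable.comp (measurable_pi_lambda _ fun i => hm _), B, fun ω => hB _ fun i => hr _ _⟩

lemma step_est {s σ : ℝ} {α : Measure ℝ} {Ω : Type} [m : MeasurableSpace Ω] {P : Measure Ω}
    [IsProbabilityMeasure P] {X : ℝ → Ω → ℝ} {C : ℝ} (hC : 0 ≤ C) (hE : WFEst s σ α P X C)
    {f : ℝ → ℝ} (hf : ContDiff ℝ 2 f) {u : ℝ} (hu : 0 ≤ u)
    {ι : Type} [Fintype ι] (τ : ι → ℝ) (hτ : ∀ i, τ i ≤ u) {g : (ι → ℝ) → ℝ} (hg : Continuous g)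
    {B : ℝ} (hB0 : 0 ≤ B) (hB : ∀ y, (∀ i, y i ∈ Icc (0:ℝ) 1) → |g y| ≤ B) (c : ℝ) (hc : 0 < c) :
    ∃ δ, 0 < δ ∧ ∀ v t, u ≤ v → v ≤ t → t - v < δ →
      |∫ x, f (X t x) * g (fun i => X (τ i) x) ∂P - ∫ x, f (X v x) * g (fun i => X (τ i) x) ∂P
        - (t - v) * ∫ x, LWF s σ f (X v x) * g (fun i => X (τ i) x) ∂P| ≤ c * (t - v) := by
  have k1 := cont_d1 hf
  have k2 := cont_d2 hf
  obtain ⟨B1, hB1⟩ := (isCompact_Icc (a := (0:ℝ)) (b := 1)).exists_bound_of_continuousOn k1.continuousOn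
  obtain ⟨B2, hB2⟩ := (isCompact_Icc (a := (0:ℝ)) (b := 1)).exists_bound_of_continuousOn k2.continuousOn
  have hB10 : 0 ≤ B1 := (norm_nonneg _).trans (hB1 0 (by simp))
  have hB20 : 0 ≤ B2 := (norm_nonneg _).trans (hB2 0 (by simp))
  set η := c / (2 * (C * B + 1)) with hη
  have hη0 : 0 < η := by positivity
  obtain ⟨K, hK, hT⟩ := taylor f hf η hη0
  have hlim : ContinuousAt (fun h : ℝ => C * (B1 * B) * √h + 1 / 2 * (C * (B2 * B)) * √h + B * (η * C + K * C * h)) 0 := by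
    fun_prop
  have hlt : (fun h : ℝ => C * (B1 * B) * √h + 1 / 2 * (C * (B2 * B)) * √h + B * (η * C + K * C * h)) 0 < c := by
    simp only [Real.sqrt_zero, mul_zero, add_zero, zero_add]
    calc B * (η * C) = c * ((C * B) / (2 * (C * B + 1))) := by rw [hη]; ring
      _ < c * 1 := by
        gcongr
        rw [div_lt_one (by positivity)]
        nlinarith [mul_nonneg hC hB0]
      _ = c := mul_one c
  have hev := hlim.eventually (gt_mem_nhds hlt)
  rw [Metric.eventually_nhds_iff] at hev
  obtain ⟨δ, hδ, hev⟩ := hev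
  refine ⟨δ, hδ, fun v t huv hvt htv => ?_⟩
  have hh : 0 ≤ t - v := sub_nonneg.2 hvt
  have hev' := hev (y := t - v) (by rw [Real.dist_eq, sub_zero, abs_of_nonneg hh]; exact htv)
  have hm := hE.meas
  have hr := hE.range
  have hG : BM m (fun ω => g (fun i => X (τ i) ω)) := BM_cyl hm hr τ hg hB
  have hX : ∀ t, BM m (X t) := fun t => BM.of01 (hm t) (hr t)
  have hφ : ∀ (φ : ℝ → ℝ), Continuous φ → ∀ t, BM m (fun ω => φ (X t ω)) :=
    fun φ hφ t => BM.comp01 hφ (hm t) (hr t)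
  have hD := (hX t).sub (hX v)
  have q1 := hE.d1 v t (hu.trans huv) hvt (Option ι) (fun o => o.elim v τ)
    (fun o => by cases o with
      | none => simp
      | some i => exact (hτ i).trans huv)
    (fun y => deriv f (y none) * g (fun i => y (some i))) (by fun_prop) (B1 * B) (by positivity)
    (fun y hy => by
      rw [abs_mul]
      exact mul_le_mul (hB1 _ (hy _)) (hB _ fun i => hy _) (abs_nonneg _) hB10)
  have q2 := hE.d2 v t (hu.trans huv) hvt (Option ι) (fun o => o.elim v τ)
    (fun o => by cases o with
      | none => simp
      | some i => exact (hτ i).trans huv)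
    (fun y => deriv (deriv f) (y none) * g (fun i => y (some i))) (by fun_prop) (B2 * B) (by positivity)
    (fun y hy => by
      rw [abs_mul]
      exact mul_le_mul (hB2 _ (hy _)) (hB _ fun i => hy _) (abs_nonneg _) hB20)
  simp only [Option.elim] at q1 q2
  set G := fun ω => g (fun i => X (τ i) ω) with hGdef
  have e2 := hE.e2 v t (hu.trans huv) hvt
  have e4 := hE.e4 v t (hu.trans huv) hvt
  set R := fun x => f (X t x) - f (X v x) - deriv f (X v x) * (X t x - X v x)
    - 1 / 2 * deriv (deriv f) (X v x) * (X t x - X v x) ^ 2 with hR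
  have hRm : BM m R := (((hφ f hf.continuous t).sub (hφ f hf.continuous v)).sub
    ((hφ _ k1 v).mul hD)).sub (((BM.const _).mul (hφ _ k2 v)).mul (hD.pow 2))
  have hRb : |∫ x, R x * G x ∂P| ≤ B * (η * (C * (t - v)) + K * (C * (t - v) ^ 2)) := by
    calc |∫ x, R x * G x ∂P| ≤ ∫ x, |R x * G x| ∂P := abs_integral_le_integral_abs
      _ ≤ ∫ x, B * (η * (X t x - X v x) ^ 2 + K * (X t x - X v x) ^ 4) ∂P := by
        refine integral_mono ((hRm.mul hG).abs.int P) (((BM.const B).mul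
          (((BM.const η).mul (hD.pow 2)).add ((BM.const K).mul (hD.pow 4)))).int P) fun x => ?_
        simp only [abs_mul]
        rw [mul_comm]
        refine mul_le_mul (hB _ fun i => hr _ _) ((hT _ (hr v x) _ (hr t x)).trans (le_of_eq (by ring)))
          (abs_nonneg _) hB0
      _ = B * (η * ∫ x, (X t x - X v x) ^ 2 ∂P + K * ∫ x, (X t x - X v x) ^ 4 ∂P) := by
        rw [integral_const_mul, integral_add (((BM.const η).mul (hD.pow 2)).int P)
          (((BM.const K).mul (hD.pow 4)).int P), integral_const_mul, integral_const_mul]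
      _ ≤ _ := by gcongr
  have id1 : ∫ x, f (X t x) * G x ∂P - ∫ x, f (X v x) * G x ∂P =
      ∫ x, (X t x - X v x) * (deriv f (X v x) * G x) ∂P
      + 1 / 2 * ∫ x, (X t x - X v x) ^ 2 * (deriv (deriv f) (X v x) * G x) ∂P + ∫ x, R x * G x ∂P := by
    have i1 := (hD.mul ((hφ _ k1 v).mul hG)).int P
    have i2 := ((BM.const (1/2)).mul ((hD.pow 2).mul ((hφ _ k2 v).mul hG))).int P
    have i3 := ((hD.mul ((hφ _ k1 v).mul hG)).add
      ((BM.const (1/2)).mul ((hD.pow 2).mul ((hφ _ k2 v).mul hG)))).int P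
    rw [← integral_sub (((hφ f hf.continuous t).mul hG).int P) (((hφ f hf.continuous v).mul hG).int P),
      ← integral_const_mul, ← integral_add i1 i2, ← integral_add i3 ((hRm.mul hG).int P)]
    refine integral_congr_ae (ae_of_all _ fun x => ?_)
    simp only [hR]
    ring
  have id2 : ∫ x, LWF s σ f (X v x) * G x ∂P = ∫ x, bfun s (X v x) * (deriv f (X v x) * G x) ∂P
      + 1 / 2 * ∫ x, afun σ (X v x) * (deriv (deriv f) (X v x) * G x) ∂P := by
    have i1 := ((hφ _ (cont_bfun s) v).mul ((hφ _ k1 v).mul hG)).int P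
    have i2 := ((BM.const (1/2)).mul ((hφ _ (cont_afun σ) v).mul ((hφ _ k2 v).mul hG))).int P
    rw [← integral_const_mul, ← integral_add i1 i2]
    refine integral_congr_ae (ae_of_all _ fun x => ?_)
    simp only [LWF_eq]
    ring
  rw [id1, id2]
  have hfin := mul_le_mul_of_nonneg_left hev'.le hh
  rw [abs_le] at q1 q2 hRb ⊢
  constructor <;> nlinarith [q1.1, q1.2, q2.1, q2.2, hRb.1, hRb.2]

end WFX

namespace WFX

lemma BM_intI {Ω : Type} {m : MeasurableSpace Ω} {X : ℝ → Ω → ℝ}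
    (hr : ∀ t ω, X t ω ∈ Icc (0:ℝ) 1) (hc : ∀ ω, Continuous fun t => X t ω)
    {φ : ℝ → ℝ} (hφ : Continuous φ) (u t : ℝ) (hm : ∀ v ≤ t, Measurable[m] (X v)) :
    BM m (fun ω => ∫ v in Ioc u t, φ (X v ω)) := by
  obtain ⟨C, hC⟩ := (isCompact_Icc (a := (0:ℝ)) (b := 1)).exists_bound_of_continuousOn hφ.continuousOn
  refine ⟨?_, C * (volume : Measure ℝ).real (Ioc u t), fun ω => ?_⟩
  · have h1 : Measurable (Function.uncurry fun (v : ℝ) (ω : Ω) => φ (X (min v t) ω)) := by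
      refine measurable_uncurry_of_continuous_of_measurable (fun ω => ?_) (fun v => ?_)
      · exact hφ.comp ((hc ω).comp (continuous_id.min continuous_const))
      · exact hφ.measurable.comp (hm _ (min_le_right _ _))
    have h2 := (h1.stronglyMeasurable.integral_prod_left (μ := (volume : Measure ℝ).restrict (Ioc u t))).measurable
    convert h2 using 1
    ext ω
    refine setIntegral_congr_fun measurableSet_Ioc fun v hv => ?_
    simp only [Function.uncurry, min_eq_left hv.2]
  · exact norm_setIntegral_le_of_norm_le_const (by simp) fun v _ => hC _ (hr v ω)

lemma mart_cyl {s σ : ℝ} {α : Measure ℝ} {Ω : Type} [m : MeasurableSpace Ω] {P : Measure Ω}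
    [IsProbabilityMeasure P] {X : ℝ → Ω → ℝ} {C : ℝ} (hC : 0 ≤ C) (hE : WFEst s σ α P X C)
    (hc : ∀ ω, Continuous fun t => X t ω)
    {f : ℝ → ℝ} (hf : ContDiff ℝ 2 f) {u t : ℝ} (hu : 0 ≤ u) (hut : u ≤ t)
    {ι : Type} [Fintype ι] (τ : ι → ℝ) (hτ : ∀ i, τ i ≤ u) {g : (ι → ℝ) → ℝ} (hg : Continuous g)
    {B : ℝ} (hB0 : 0 ≤ B) (hB : ∀ y, (∀ i, y i ∈ Icc (0:ℝ) 1) → |g y| ≤ B) :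
    ∫ x, (f (X t x) - f (X u x) - ∫ v in Ioc u t, LWF s σ f (X v x)) * g (fun i => X (τ i) x) ∂P = 0 := by
  have hm := hE.meas
  have hr := hE.range
  have hG : BM m (fun ω => g (fun i => X (τ i) ω)) := BM_cyl hm hr τ hg hB
  have hφ : ∀ (φ : ℝ → ℝ), Continuous φ → ∀ t, BM m (fun ω => φ (X t ω)) :=
    fun φ hφ t => BM.comp01 hφ (hm t) (hr t)
  have hL : Continuous (LWF s σ f) := cont_LWF hf
  set G := fun ω => g (fun i => X (τ i) ω) with hGdef
  have hcont : ∀ φ : ℝ → ℝ, Continuous φ → Continuous fun v => ∫ x, φ (X v x) * G x ∂P := by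
    intro φ hφc
    obtain ⟨K, hK⟩ := (isCompact_Icc (a := (0:ℝ)) (b := 1)).exists_bound_of_continuousOn hφc.continuousOn
    refine continuous_of_dominated (bound := fun _ => K * B) ?_ ?_ (integrable_const _) ?_
    · intro v; exact ((hφ φ hφc v).mul hG).1.aestronglyMeasurable
    · intro v
      refine ae_of_all _ fun x => ?_
      rw [norm_mul]
      exact mul_le_mul (hK _ (hr _ _)) (hB _ fun i => hr _ _) (norm_nonneg _) ((norm_nonneg _).trans (hK _ (hr v x)))
    · refine ae_of_all _ fun x => ?_
      exact (hφc.comp (hc x)).mul continuous_const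
  have hder : ∀ v ∈ Ioo u t, HasDerivWithinAt (fun v => ∫ x, f (X v x) * G x ∂P)
      (∫ x, LWF s σ f (X v x) * G x ∂P) (Ioi v) v := by
    intro v hv
    rw [hasDerivWithinAt_iff_isLittleO, Asymptotics.isLittleO_iff]
    intro c hc'
    obtain ⟨δ, hδ, h⟩ := step_est hC hE hf hu τ hτ hg hB0 hB c hc'
    have : Ioo v (v + δ) ∈ 𝓝[>] v := Ioo_mem_nhdsGT (by linarith)
    filter_upwards [this] with w hw
    have := h v w hv.1.le hw.1.le (by linarith [hw.2])
    rw [Real.norm_eq_abs, Real.norm_eq_abs, abs_of_nonneg (sub_nonneg.2 hw.1.le), smul_eq_mul]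
    exact this
  have hint := intervalIntegral.integral_eq_sub_of_hasDeriv_right_of_le hut
    (hcont f hf.continuous).continuousOn hder ((hcont _ hL).intervalIntegrable u t)
  rw [intervalIntegral.integral_of_le hut] at hint
  have hsw : ∫ v in Ioc u t, ∫ x, LWF s σ f (X v x) * G x ∂P
      = ∫ x, (∫ v in Ioc u t, LWF s σ f (X v x) * G x) ∂P := by
    refine integral_integral_swap ?_
    obtain ⟨K, hK⟩ := (isCompact_Icc (a := (0:ℝ)) (b := 1)).exists_bound_of_continuousOn hL.continuousOn
    refine Integrable.of_bound (C := K * B) ?_ (ae_of_all _ fun z => ?_)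
    · refine Measurable.aestronglyMeasurable ?_
      refine measurable_uncurry_of_continuous_of_measurable (fun ω => ?_) (fun v => ?_)
      · exact (hL.comp (hc ω)).mul continuous_const
      · exact ((hφ _ hL v).mul hG).1
    · simp only [Function.uncurry, norm_mul]
      exact mul_le_mul (hK _ (hr _ _)) (hB _ fun i => hr _ _) (norm_nonneg _) ((norm_nonneg _).trans (hK _ (hr z.1 z.2)))
  have hI : BM m (fun ω => ∫ v in Ioc u t, LWF s σ f (X v ω)) := BM_intI hr hc hL u t fun v _ => hm v
  simp_rw [integral_mul_const] at hsw
  rw [hsw] at hint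
  have e : ∀ x, (f (X t x) - f (X u x) - ∫ v in Ioc u t, LWF s σ f (X v x)) * G x
      = (f (X t x) * G x - f (X u x) * G x) - (∫ v in Ioc u t, LWF s σ f (X v x)) * G x := fun x => by ring
  have i1 := (hφ f hf.continuous t).mul hG
  have i2 := (hφ f hf.continuous u).mul hG
  calc _ = ∫ x, ((f (X t x) * G x - f (X u x) * G x) - (∫ v in Ioc u t, LWF s σ f (X v x)) * G x) ∂P :=
        integral_congr_ae (ae_of_all _ e)
    _ = 0 := by
      rw [integral_sub ((i1.sub i2).int P) ((hI.mul hG).int P), integral_sub (i1.int P) (i2.int P), hint]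
      ring

/-- the σ-algebra of the past -/
@[reducible] def past {Ω : Type} (X : ℝ → Ω → ℝ) (u : ℝ) : MeasurableSpace Ω :=
  ⨆ j ∈ Iic u, MeasurableSpace.comap (X j) (borel ℝ)

lemma set_ext {Ω : Type} [m : MeasurableSpace Ω] {P : Measure Ω}
    [IsProbabilityMeasure P] {X : ℝ → Ω → ℝ} (hm : ∀ t, Measurable (X t))
    (hr : ∀ t ω, X t ω ∈ Icc (0:ℝ) 1) {D : Ω → ℝ} (hD : BM m D) (u : ℝ)
    (h : ∀ (ι : Type) [Fintype ι] (τ : ι → ℝ), (∀ i, τ i ≤ u) → ∀ g : (ι → ℝ) → ℝ, Continuous g →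
      (∀ y, (∀ i, y i ∈ Icc (0:ℝ) 1) → |g y| ≤ 1) → ∫ x, D x * g (fun i => X (τ i) x) ∂P = 0)
    (S : Set Ω) (hS : MeasurableSet[past X u] S) : ∫ x in S, D x ∂P = 0 := by
  let π : ℝ → Set (Set Ω) := fun j => {A | ∃ F : Set ℝ, IsClosed F ∧ X j ⁻¹' F = A}
  have hπ : ∀ j, IsPiSystem (π j) := by
    rintro j _ ⟨F, hF, rfl⟩ _ ⟨F', hF', rfl⟩ _
    exact ⟨F ∩ F', hF.inter hF', rfl⟩
  have hgen : ∀ j, MeasurableSpace.comap (X j) (borel ℝ) = MeasurableSpace.generateFrom (π j) := by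
    intro j
    rw [borel_eq_generateFrom_isClosed, MeasurableSpace.comap_generateFrom]
    rfl
  have hbor : borel ℝ = (inferInstance : MeasurableSpace ℝ) := BorelSpace.measurable_eq.symm
  have hle : ∀ j, MeasurableSpace.comap (X j) (borel ℝ) ≤ m := by
    intro j; rw [hbor]; exact (hm j).comap_le
  have hpast : past X u = MeasurableSpace.generateFrom (piiUnionInter π (Iic u)) := by
    refine le_antisymm (iSup₂_le fun j hj => ?_) (MeasurableSpace.generateFrom_le ?_)
    · rw [hgen j]; exact le_generateFrom_piiUnionInter _ hj
    · rintro _ ⟨I, hI, F, hF, rfl⟩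
      refine Finset.measurableSet_biInter _ fun j hj => ?_
      have h1 : MeasurableSpace.comap (X j) (borel ℝ) ≤ past X u :=
        le_iSup₂_of_le (f := fun j (_ : j ∈ Iic u) => MeasurableSpace.comap (X j) (borel ℝ)) j (hI hj) le_rfl
      refine h1 _ ?_
      rw [hgen j]
      exact MeasurableSpace.measurableSet_generateFrom (hF j hj)
  have hpm : past X u ≤ m := iSup₂_le fun j _ => hle j
  have hall : ∫ x, D x ∂P = 0 := by
    have := h Empty (fun i => i.elim) (fun i => i.elim) (fun _ => 1) continuous_const (by simp)
    simpa using this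
  induction S, hS using MeasurableSpace.induction_on_inter hpast (isPiSystem_piiUnionInter π hπ _) with
  | empty => simp
  | basic A hA =>
    obtain ⟨I, hI, F, hF, rfl⟩ := hA
    choose! Fc hcl hpre using hF
    have hint : ∀ n, ∫ x, D x * ∏ i : I, ((hcl i i.2).apprSeq n (X i x) : ℝ) ∂P = 0 := fun n =>
      h I (fun i => (i : ℝ)) (fun i => hI i.2) (fun y => ∏ i : I, ((hcl i i.2).apprSeq n (y i) : ℝ))
        (continuous_finsetProd _ fun i _ => by fun_prop) (fun y _ => by
          rw [Finset.abs_prod]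
          refine Finset.prod_le_one (fun i _ => abs_nonneg _) fun i _ => ?_
          rw [abs_of_nonneg NNReal.zero_le_coe]
          exact_mod_cast HasOuterApproxClosed.apprSeq_apply_le_one (hcl i i.2) n (y i))
    obtain ⟨K, hK⟩ := hD.2
    have hlim : Tendsto (fun n => ∫ x, D x * ∏ i : I, ((hcl i i.2).apprSeq n (X i x) : ℝ) ∂P) atTop
        (𝓝 (∫ x, (⋂ j ∈ I, F j).indicator D x ∂P)) := by
      refine tendsto_integral_of_dominated_convergence (fun _ => K) ?_ (integrable_const _) ?_ ?_
      · intro n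
        refine Measurable.aestronglyMeasurable ?_
        refine hD.1.mul (Finset.measurable_prod _ fun i _ => ?_)
        exact measurable_coe_nnreal_real.comp (((hcl i i.2).apprSeq n).continuous.measurable.comp (hm i))
      · intro n
        refine ae_of_all _ fun x => ?_
        rw [norm_mul, ← mul_one K]
        refine mul_le_mul (hK x) ?_ (norm_nonneg _) ((abs_nonneg _).trans (hK x))
        rw [Real.norm_eq_abs, Finset.abs_prod]
        refine Finset.prod_le_one (fun i _ => abs_nonneg _) fun i _ => ?_
        rw [abs_of_nonneg NNReal.zero_le_coe]
        exact_mod_cast HasOuterApproxClosed.apprSeq_apply_le_one (hcl i i.2) n (X i x)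
      · refine ae_of_all _ fun x => ?_
        have h1 : ∀ i : I, Tendsto (fun n => ((hcl i i.2).apprSeq n (X i x) : ℝ)) atTop
            (𝓝 ((indicator (Fc i) (fun _ => (1 : ℝ≥0)) (X i x) : ℝ≥0) : ℝ)) := fun i =>
          (NNReal.continuous_coe.tendsto _).comp
            ((tendsto_pi_nhds.1 (HasOuterApproxClosed.tendsto_apprSeq (hcl i i.2))) (X i x))
        have h2 := (tendsto_finsetProd Finset.univ fun i (_ : i ∈ Finset.univ) => h1 i).const_mul (D x)
        convert h2 using 2
        by_cases hx : x ∈ ⋂ j ∈ I, F j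
        · rw [indicator_of_mem hx, Finset.prod_eq_one ?_, mul_one]
          intro i _
          have : x ∈ F i := by
            simp only [mem_iInter] at hx
            exact hx i i.2
          rw [← hpre i i.2] at this
          rw [indicator_of_mem (show X i x ∈ Fc i from this)]; rfl
        · rw [indicator_of_notMem hx]
          simp only [mem_iInter, not_forall] at hx
          obtain ⟨j, hj, hx⟩ := hx
          rw [Finset.prod_eq_zero (Finset.mem_univ (⟨j, hj⟩ : I)), mul_zero]
          rw [← hpre j hj] at hx
          rw [indicator_of_notMem (show X j x ∉ Fc j from hx)]; rfl
    have hms : MeasurableSet (⋂ j ∈ I, F j) := by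
      refine Finset.measurableSet_biInter _ fun j hj => ?_
      rw [← hpre j hj]
      exact hm j (hcl j hj).measurableSet
    rw [← integral_indicator hms]
    refine tendsto_nhds_unique hlim ?_
    simp only [hint, tendsto_const_nhds]
  | compl A hA ih =>
    have := integral_add_compl (hpm _ hA) (hD.int P)
    linarith
  | iUnion A hd hA ih =>
    rw [integral_iUnion (fun i => hpm _ (hA i)) hd (hD.int P).integrableOn]
    simp [ih]
end WFX

namespace WFX

/-- the natural filtration -/
def filt {Ω : Type} [m : MeasurableSpace Ω] (X : ℝ → Ω → ℝ) (hm : ∀ t, Measurable (X t)) :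
    Filtration ℝ m where
  seq := past X
  mono' := fun _ _ h => biSup_mono fun _ hj => le_trans hj h
  le' := fun _ => iSup₂_le fun j _ => by
    rw [show borel ℝ = (inferInstance : MeasurableSpace ℝ) from BorelSpace.measurable_eq.symm]
    exact (hm j).comap_le

lemma meas_past {Ω : Type} {X : ℝ → Ω → ℝ} {v t : ℝ} (h : v ≤ t) : Measurable[past X t] (X v) := by
  rw [measurable_iff_comap_le, show Real.measurableSpace = borel ℝ from BorelSpace.measurable_eq]
  exact le_iSup₂_of_le (f := fun j (_ : j ∈ Iic t) => MeasurableSpace.comap (X j) (borel ℝ)) v h le_rfl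

lemma mart {s σ : ℝ} {α : Measure ℝ} {Ω : Type} [m : MeasurableSpace Ω] {P : Measure Ω}
    [IsProbabilityMeasure P] {X : ℝ → Ω → ℝ} {C : ℝ} (hC : 0 ≤ C) (hE : WFEst s σ α P X C)
    (hc : ∀ ω, Continuous fun t => X t ω) (h0 : ∀ t, X t = X (max t 0))
    {f : ℝ → ℝ} (hf : ContDiff ℝ 2 f) :
    Martingale (fun t ω => f (X t ω) - ∫ u in Ioc (0:ℝ) t, LWF s σ f (X u ω)) (filt X hE.meas) P := by
  have hr := hE.range
  have hL : Continuous (LWF s σ f) := cont_LWF hf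
  have hM : ∀ t, BM (past X t) (fun ω => f (X t ω) - ∫ u in Ioc (0:ℝ) t, LWF s σ f (X u ω)) := fun t =>
    (BM.comp01 hf.continuous (meas_past le_rfl) (hr t)).sub
      (BM_intI hr hc hL 0 t fun v hv => meas_past hv)
  have hle : ∀ t, past X t ≤ m := (filt X hE.meas).le
  have hint : ∀ t, Integrable (fun ω => f (X t ω) - ∫ u in Ioc (0:ℝ) t, LWF s σ f (X u ω)) P :=
    fun t => ((hM t).mono (hle t)).int P
  refine ⟨fun t => (hM t).1.stronglyMeasurable, fun u t hut => ?_⟩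
  symm
  refine ae_eq_condExp_of_forall_setIntegral_eq (hle u) (hint t) (fun S _ _ => (hint u).integrableOn) ?_
    (hM u).1.stronglyMeasurable.aestronglyMeasurable
  intro S hS _
  set u' := max u 0 with hu'
  set t' := max t 0 with ht'
  have hu0 : 0 ≤ u' := le_max_right _ _
  have hut' : u' ≤ t' := max_le_max hut le_rfl
  have hS' : MeasurableSet[past X u'] S := (filt X hE.meas).mono (le_max_left u 0) _ hS
  have hIoc : ∀ v : ℝ, Ioc (0:ℝ) v = Ioc 0 (max v 0) := fun v => by
    rcases le_total v 0 with h | h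
    · rw [max_eq_right h, Ioc_self, Ioc_eq_empty (not_lt.2 h)]
    · rw [max_eq_left h]
  have key := set_ext hE.meas hr
    (D := fun ω => f (X t' ω) - f (X u' ω) - ∫ v in Ioc u' t', LWF s σ f (X v ω))
    (((BM.comp01 hf.continuous (hE.meas _) (hr t')).sub (BM.comp01 hf.continuous (hE.meas _) (hr u'))).sub
      (BM_intI hr hc hL u' t' fun v _ => hE.meas v)) u'
    (fun ι _ τ hτ g hg hB => mart_cyl hC hE hc hf hu0 hut' τ hτ hg zero_le_one hB) S hS'
  have e : ∀ ω, f (X t' ω) - f (X u' ω) - ∫ v in Ioc u' t', LWF s σ f (X v ω) =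
      (f (X t ω) - ∫ v in Ioc (0:ℝ) t, LWF s σ f (X v ω)) - (f (X u ω) - ∫ v in Ioc (0:ℝ) u, LWF s σ f (X v ω)) := by
    intro ω
    rw [hIoc t, hIoc u, h0 t, h0 u, ← hu', ← ht', ← intervalIntegral.integral_of_le hut',
      ← intervalIntegral.integral_of_le hu0, ← intervalIntegral.integral_of_le (hu0.trans hut')]
    have hcc : Continuous fun v => LWF s σ f (X v ω) := hL.comp (hc ω)
    rw [← intervalIntegral.integral_add_adjacent_intervals (hcc.intervalIntegrable 0 u')
      (hcc.intervalIntegrable u' t')]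
    ring
  simp_rw [e] at key
  rw [integral_sub (hint t).integrableOn (hint u).integrableOn] at key
  linarith

lemma est_prod {s σ : ℝ} {α : Measure ℝ} {Ω Ω' : Type} [MeasurableSpace Ω] [MeasurableSpace Ω']
    {P : Measure Ω} {Q : Measure Ω'} [IsProbabilityMeasure P] [IsProbabilityMeasure Q]
    {X : ℝ → Ω → ℝ} {C : ℝ} (hE : WFEst s σ α P X C) :
    WFEst s σ α (P.prod Q) (fun t (z : Ω × Ω') => X t z.1) C := by
  have hI : ∀ f : Ω → ℝ, ∫ z, f z.1 ∂(P.prod Q) = ∫ x, f x ∂P := fun f => by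
    rw [integral_fun_fst]; simp
  refine ⟨fun t => (hE.meas t).comp measurable_fst, fun t z => hE.range t z.1, ?_, ?_, ?_, ?_, ?_⟩
  · rw [← hE.init]
    have : (fun z : Ω × Ω' => X 0 z.1) = X 0 ∘ Prod.fst := rfl
    rw [this, ← Measure.map_map (hE.meas 0) measurable_fst, measurePreserving_fst.map_eq]
  · intro u t hu hut
    rw [hI fun x => (X t x - X u x) ^ 2]; exact hE.e2 u t hu hut
  · intro u t hu hut
    rw [hI fun x => (X t x - X u x) ^ 4]; exact hE.e4 u t hu hut
  · intro u t hu hut ι _ τ hτ g hg B hB0 hB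
    rw [hI fun x => (X t x - X u x) * g (fun i => X (τ i) x),
      hI fun x => bfun s (X u x) * g (fun i => X (τ i) x)]
    exact hE.d1 u t hu hut ι τ hτ g hg B hB0 hB
  · intro u t hu hut ι _ τ hτ g hg B hB0 hB
    rw [hI fun x => (X t x - X u x) ^ 2 * g (fun i => X (τ i) x),
      hI fun x => afun σ (X u x) * g (fun i => X (τ i) x)]
    exact hE.d2 u t hu hut ι τ hτ g hg B hB0 hB

lemma exists_killed (s σ : ℝ) (hs : 0 < s) (hσ : 0 < σ) (r : ℝ → ℝ) (α : Measure ℝ) [IsProbabilityMeasure α]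
    (hα : α (Ioo (0:ℝ) 1)ᶜ = 0) : Nonempty (WFKilled s σ r α) := by
  obtain ⟨P, hP, X, C, hC, hE, hc, h0⟩ := exists_est_cont s σ hs hσ α hα
  have : IsProbabilityMeasure (expMeasure 1) := isProbabilityMeasure_expMeasure one_pos
  have hE' := est_prod (Q := expMeasure 1) hE
  refine ⟨{ Ω := PathSp × ℝ, P := P.prod (expMeasure 1), probP := inferInstance,
            X := fun t z => X t z.1, measX := hE'.meas, contX := fun z => hc z.1,
            preZero := ?_, range01 := hE'.range, initLaw := hE'.init,
            ℱ := filt _ hE'.meas, adaptedX := fun t => meas_past (X := fun t (z : PathSp × ℝ) => X t z.1) le_rfl,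
            martProblem := fun f hf => mart hC hE' (fun z => hc z.1) ?_ hf,
            Tkill := Prod.snd, measT := measurable_snd, expLaw := ?_, indepT := ?_ }⟩
  · intro t ht
    ext z
    rw [h0 t, max_eq_right ht]
  · intro t
    ext z
    rw [h0 t]
  · intro t ht
    have h1 : {z : PathSp × ℝ | t < z.2} = univ ×ˢ Ioi t := by ext z; simp
    rw [h1, Measure.prod_prod, measure_univ, one_mul]
    have h2 := cdf_expMeasure_eq one_pos t
    rw [if_pos ht, cdf_eq_real] at h2
    have h3 : (expMeasure 1).real (Ioi t) = Real.exp (-t) := by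
      rw [← compl_Iic, probReal_compl_eq_one_sub measurableSet_Iic, h2]
      simp
    rw [← h3, ofReal_measureReal]
  · exact indepFun_prod (X := fun ω t => X t ω) (Y := id)
      (measurable_pi_lambda _ fun t => hE.meas t) measurable_id

end WFX

namespace WFX

lemma rate_ge (s : ℝ) (hs : 0 < s) (σ : ℝ) (hσ : s ≤ σ ^ 2) (r : ℝ → ℝ) (α : Measure ℝ) [IsProbabilityMeasure α]
    (hα : α (Ioo (0:ℝ) 1)ᶜ = 0) (ρ : ℝ) (W : WFKilled s σ r α)
    (hq : ∀ A : Set ℝ, MeasurableSet A →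
      W.P ({ω | W.X 1 ω ∈ A} ∩ W.aliveAll 1) = ENNReal.ofReal (Real.exp (-(ρ * 1))) * α A) :
    σ ^ 2 - s ≤ ρ := by
  set f : ℝ → ℝ := fun x => x * (1 - x) with hf
  have hfc : ContDiff ℝ 2 f := by fun_prop
  have hd1 : deriv f = fun x => 1 - 2 * x := by
    ext x
    have := (hasDerivAt_id x).mul ((hasDerivAt_id x).const_sub 1)
    refine (this.congr_deriv ?_).deriv
    simp only [id]; ring
  have hd2 : deriv (deriv f) = fun _ => -2 := by
    rw [hd1]; ext x
    have := ((hasDerivAt_id x).const_mul 2).const_sub 1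
    refine (this.congr_deriv ?_).deriv
    ring
  set c := σ ^ 2 - s with hcdef
  have hLle : ∀ x ∈ Icc (0:ℝ) 1, LWF s σ f x ≤ - c * f x := by
    intro x hx
    unfold LWF
    rw [hd2, hd1]
    simp only [hf]
    have h1 := (xx_bd hx).1
    have : 0 ≤ s * (x * (1 - x)) * (1 - x) := mul_nonneg (mul_nonneg hs.le h1) (sub_nonneg.2 hx.2)
    nlinarith
  have hL : Continuous (LWF s σ f) := cont_LWF hfc
  have hr := W.range01
  have hm := W.measX
  have hφ : ∀ (φ : ℝ → ℝ), Continuous φ → ∀ t, BM W.mΩ (fun ω => φ (W.X t ω)) :=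
    fun φ hφ t => BM.comp01 hφ (hm t) (hr t)
  have hcont : ∀ φ : ℝ → ℝ, Continuous φ → Continuous fun v => ∫ x, φ (W.X v x) ∂W.P := by
    intro φ hφc
    obtain ⟨K, hK⟩ := (isCompact_Icc (a := (0:ℝ)) (b := 1)).exists_bound_of_continuousOn hφc.continuousOn
    refine continuous_of_dominated (bound := fun _ => K) ?_ ?_ (integrable_const _) ?_
    · intro v; exact (hφ φ hφc v).1.aestronglyMeasurable
    · intro v
      exact ae_of_all _ fun x => hK _ (hr _ _)
    · exact ae_of_all _ fun x => hφc.comp (W.contX x)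
  set mm := fun v => ∫ x, f (W.X v x) ∂W.P with hmm
  set ll := fun v => ∫ x, LWF s σ f (W.X v x) ∂W.P with hll
  have hllm : ∀ v, ll v ≤ - c * mm v := by
    intro v
    rw [hmm, ← integral_const_mul]
    exact integral_mono ((hφ _ hL v).int _) (((BM.const _).mul (hφ _ hfc.continuous v)).int _)
      fun x => hLle _ (hr v x)
  have hmart : ∀ t, 0 ≤ t → mm t = mm 0 + ∫ v in (0:ℝ)..t, ll v := by
    intro t ht
    have h1 := (W.martProblem f hfc).setIntegral_eq ht MeasurableSet.univ
    simp only [Measure.restrict_univ, Ioc_self, Measure.restrict_empty, integral_zero_measure, sub_zero] at h1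
    rw [integral_sub ((hφ _ hfc.continuous t).int _)
      ((BM_intI hr W.contX hL 0 t fun v _ => hm v).int _)] at h1
    have hsw : ∫ v in Ioc 0 t, ∫ x, LWF s σ f (W.X v x) ∂W.P
        = ∫ x, (∫ v in Ioc 0 t, LWF s σ f (W.X v x)) ∂W.P := by
      refine integral_integral_swap ?_
      obtain ⟨K, hK⟩ := (isCompact_Icc (a := (0:ℝ)) (b := 1)).exists_bound_of_continuousOn hL.continuousOn
      refine Integrable.of_bound (C := K) ?_ (ae_of_all _ fun z => hK _ (hr _ _))
      refine Measurable.aestronglyMeasurable ?_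
      exact measurable_uncurry_of_continuous_of_measurable (fun ω => hL.comp (W.contX ω))
        (fun v => (hφ _ hL v).1)
    rw [intervalIntegral.integral_of_le ht, hll, hsw, hmm]
    simp only
    linarith
  have hdec : mm 1 ≤ Real.exp (-c) * mm 0 := by
    have hlc : Continuous ll := hcont _ hL
    have hder : ∀ t, HasDerivAt (fun t => Real.exp (c * t) * (mm 0 + ∫ v in (0:ℝ)..t, ll v))
        (Real.exp (c * t) * (c * (mm 0 + ∫ v in (0:ℝ)..t, ll v) + ll t)) t := by
      intro t
      have h1 := (((hasDerivAt_id t).const_mul c).exp).mul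
        ((hlc.integral_hasStrictDerivAt 0 t).hasDerivAt.const_add (mm 0))
      refine h1.congr_deriv ?_
      simp only [id]; ring
    have hanti : AntitoneOn (fun t => Real.exp (c * t) * (mm 0 + ∫ v in (0:ℝ)..t, ll v)) (Icc 0 1) := by
      refine antitoneOn_of_deriv_nonpos (convex_Icc 0 1)
        (fun t _ => (hder t).continuousAt.continuousWithinAt)
        (fun t _ => (hder t).differentiableAt.differentiableWithinAt) fun t ht => ?_
      rw [interior_Icc] at ht
      rw [(hder t).deriv, ← hmart t ht.1.le]
      exact mul_nonpos_of_nonneg_of_nonpos (Real.exp_pos _).le (by linarith [hllm t])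
    have := hanti (left_mem_Icc.2 zero_le_one) (right_mem_Icc.2 zero_le_one) zero_le_one
    simp only [mul_one, mul_zero, Real.exp_zero, one_mul, intervalIntegral.integral_same, add_zero] at this
    rw [← hmart 1 zero_le_one] at this
    calc mm 1 = Real.exp (-c) * (Real.exp c * mm 1) := by rw [← mul_assoc, ← Real.exp_add]; simp
      _ ≤ _ := by gcongr
  have h0 : mm 0 = ∫ x, f x ∂α := by
    rw [← W.initLaw, integral_map (hm 0).aemeasurable hfc.continuous.aestronglyMeasurable]
  have hmap : (W.P.restrict (W.aliveAll 1)).map (W.X 1) = ENNReal.ofReal (Real.exp (-ρ)) • α := by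
    ext A hA
    rw [Measure.map_apply (hm 1) hA, Measure.restrict_apply (hm 1 hA), Measure.smul_apply, smul_eq_mul]
    have := hq A hA
    rw [mul_one] at this
    exact this
  have hge : Real.exp (-ρ) * ∫ x, f x ∂α ≤ mm 1 := by
    calc Real.exp (-ρ) * ∫ x, f x ∂α = ∫ x, f x ∂(ENNReal.ofReal (Real.exp (-ρ)) • α) := by
          rw [integral_smul_measure, ENNReal.toReal_ofReal (Real.exp_pos _).le, smul_eq_mul]
      _ = ∫ x, f (W.X 1 x) ∂(W.P.restrict (W.aliveAll 1)) := by
          rw [← hmap, integral_map (hm 1).aemeasurable hfc.continuous.aestronglyMeasurable]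
      _ ≤ mm 1 := integral_mono_measure Measure.restrict_le_self
          (ae_of_all _ fun x => (xx_bd (hr 1 x)).1) ((hφ _ hfc.continuous 1).int _)
  have hae : ∀ᵐ x ∂α, x ∈ Ioo (0:ℝ) 1 := hα
  have hfi : Integrable f α := by
    refine Integrable.of_bound (C := 1) hfc.continuous.aestronglyMeasurable ?_
    filter_upwards [hae] with x hx
    have := xx_bd (Ioo_subset_Icc_self hx)
    rw [Real.norm_eq_abs, abs_of_nonneg this.1]; exact this.2
  have hpos : 0 < ∫ x, f x ∂α := by
    rw [integral_pos_iff_support_of_nonneg_ae ?_ hfi]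
    · have h1 : α (Ioo (0:ℝ) 1) = 1 := (prob_compl_eq_zero_iff measurableSet_Ioo).1 hα
      refine lt_of_lt_of_le ?_ (measure_mono (s := Ioo (0:ℝ) 1) ?_)
      · rw [h1]; exact one_pos
      · intro x hx
        exact (mul_pos hx.1 (sub_pos.2 hx.2)).ne'
    · filter_upwards [hae] with x hx
      exact (xx_bd (Ioo_subset_Icc_self hx)).1
  rw [h0] at hdec
  have := le_of_mul_le_mul_right (hge.trans hdec) hpos
  have := Real.exp_le_exp.1 this
  linarith

end WFX

/-- For the Wright–Fisher diffusion with individual-level selection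
`s > 0` and any bounded (normalized, `r ≤ 0`) group-level selection function `r`, the
extinction rate `ρ_α(σ)` of the unique QSD on `(0,1)` for `τ_{0,1,∂}` tends to `+∞`
as the neutral fluctuation parameter `σ` tends to `+∞`. -/
theorem wf_qsd_rate_tendsto_infty_with_fluctuations
    (s : ℝ) (hs : 0 < s)
    (r : ℝ → ℝ) (hrMeas : Measurable r) (hrBdd : ∃ M, ∀ x, |r x| ≤ M)
    (hrNonpos : ∀ x ∈ Icc (0:ℝ) 1, r x ≤ 0) :
    ∀ M : ℝ, ∃ σ₀ : ℝ, ∀ σ : ℝ, σ₀ < σ →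
      ∀ (α : Measure ℝ) (ρα : ℝ), IsQSD s σ r α ρα → M < ρα := by
  intro M
  refine ⟨|M| + s + 1, fun σ hσ α ρα hQ => ?_⟩
  obtain ⟨hp, hα, hq⟩ := hQ
  have h1 := abs_nonneg M
  have h2 := le_abs_self M
  have hσ0 : 0 < σ := by linarith
  have hσ2 : |M| + s < σ ^ 2 := by nlinarith
  obtain ⟨W⟩ := WFX.exists_killed s σ hs hσ0 r α hα
  have := WFX.rate_ge s hs σ (by linarith) r α hα ρα W (hq W 1 one_pos)
  linarith

end
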